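/- arXiv:0806.4048 — 7 statements merged into one kernel-verified Lean document; each statement's English description precedes it below -/
import Mathlib

section
/- For every positive integer n, max.rank_ℂ(n,n,3) ≤ 2n − 1; that is, every n×n×3 tensor over the complex numbers has rank at most 2n − 1. -/
/-- The rank of a 3-tensor, presented as a family of matrices (its slices):
the least `r` such that each slice `A k` is `∑ i, (c i k) • (a i) (b i)ᵀ`
for some vectors `a i`, `b i`, `c i`. -/
noncomputable def tensorRank (𝔽 : Type*) [Field 𝔽] {α β γ : Type*}
    [Fintype α] [Fintype β] [Fintype γ] (A : γ → Matrix α β 𝔽) : ℕ :=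
  sInf {r : ℕ | ∃ (a : Fin r → α → 𝔽) (b : Fin r → β → 𝔽) (c : Fin r → γ → 𝔽),
    ∀ k, A k = ∑ i, c i k • Matrix.vecMulVec (a i) (b i)}

/-- `maxRank 𝔽 m n p` is the maximal rank of an `m × n × p` tensor over `𝔽`. -/
noncomputable def maxRank (𝔽 : Type*) [Field 𝔽] (m n p : ℕ) : ℕ :=
  sSup {r : ℕ | ∃ A : Fin p → Matrix (Fin m) (Fin n) 𝔽, tensorRank 𝔽 A = r}

namespace TensorRank

open Matrix Polynomial Filter Topology

variable {α β γ ι κ : Type} [Fintype ι] [DecidableEq ι]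

/-- The slices `A k` form a sum of `r` simple tensors. -/
def HasDecomp (r : ℕ) (A : γ → Matrix α β ℂ) : Prop :=
  ∃ (a : Fin r → α → ℂ) (b : Fin r → β → ℂ) (c : Fin r → γ → ℂ),
    ∀ k, A k = ∑ i, c i k • vecMulVec (a i) (b i)

theorem HasDecomp.of_fintype [Fintype κ] {A : γ → Matrix α β ℂ} (a : κ → α → ℂ) (b : κ → β → ℂ)
    (c : κ → γ → ℂ) (h : ∀ k, A k = ∑ i, c i k • vecMulVec (a i) (b i)) {r : ℕ}
    (hr : Fintype.card κ = r) : HasDecomp r A := by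
  let e := Fintype.equivFinOfCardEq hr
  refine ⟨a ∘ e.symm, b ∘ e.symm, c ∘ e.symm, fun k => ?_⟩
  rw [h k]
  exact (e.symm.sum_comp (fun i => c i k • vecMulVec (a i) (b i))).symm

theorem HasDecomp.add {r s : ℕ} {A B : γ → Matrix α β ℂ} (hA : HasDecomp r A)
    (hB : HasDecomp s B) : HasDecomp (r + s) (fun k => A k + B k) := by
  obtain ⟨a, b, c, h⟩ := hA
  obtain ⟨a', b', c', h'⟩ := hB
  refine ⟨Fin.append a a', Fin.append b b', Fin.append c c', fun k => ?_⟩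
  simp [Fin.sum_univ_add, h, h']

theorem HasDecomp.add_three {r s : ℕ} {X Y Z X' Y' Z' : Matrix α β ℂ}
    (h : HasDecomp r ![X, Y, Z]) (h' : HasDecomp s ![X', Y', Z']) :
    HasDecomp (r + s) ![X + X', Y + Y', Z + Z'] := by
  convert h.add h' using 1
  ext1 k
  fin_cases k <;> rfl

theorem hasDecomp_vecMulVec (c : γ → ℂ) (a : α → ℂ) (b : β → ℂ) :
    HasDecomp 1 (fun k => c k • vecMulVec a b) :=
  ⟨fun _ => a, fun _ => b, fun _ => c, fun k => by simp⟩

theorem hasDecomp_one_three {X Y Z : Matrix α β ℂ} (x y z : ℂ) (a : α → ℂ) (b : β → ℂ)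
    (hX : ∀ i j, X i j = x * (a i * b j)) (hY : ∀ i j, Y i j = y * (a i * b j))
    (hZ : ∀ i j, Z i j = z * (a i * b j)) : HasDecomp 1 ![X, Y, Z] := by
  convert hasDecomp_vecMulVec ![x, y, z] a b using 1
  ext1 k
  fin_cases k
  exacts [Matrix.ext hX, Matrix.ext hY, Matrix.ext hZ]

theorem HasDecomp.mul {α' β' : Type} [Fintype α] [Fintype β] {r : ℕ} {A : γ → Matrix α β ℂ}
    (hA : HasDecomp r A) (P : Matrix α' α ℂ) (Q : Matrix β β' ℂ) :
    HasDecomp r (fun k => P * A k * Q) := by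
  obtain ⟨a, b, c, h⟩ := hA
  refine ⟨fun i => P *ᵥ a i, fun i => b i ᵥ* Q, c, fun k => ?_⟩
  simp [h, Matrix.mul_sum, Matrix.sum_mul, mul_vecMulVec, vecMulVec_mul]

theorem HasDecomp.of_mul {r : ℕ} {A : γ → Matrix ι ι ℂ} {P Q : Matrix ι ι ℂ} (hP : P.det ≠ 0)
    (hQ : Q.det ≠ 0) (hA : HasDecomp r (fun k => P * A k * Q)) : HasDecomp r A := by
  have := hA.mul P⁻¹ Q⁻¹
  convert this using 2 with k
  rw [Matrix.mul_assoc P, Matrix.nonsing_inv_mul_cancel_left _ _ hP.isUnit,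
    Matrix.mul_nonsing_inv_cancel_right _ _ hQ.isUnit]

theorem HasDecomp.comb {δ : Type} [Fintype γ] {r : ℕ} {A : γ → Matrix α β ℂ}
    (hA : HasDecomp r A) (T : δ → γ → ℂ) : HasDecomp r (fun k => ∑ l, T k l • A l) := by
  obtain ⟨a, b, c, h⟩ := hA
  refine ⟨a, b, fun i k => ∑ l, T k l * c i l, fun k => ?_⟩
  simp only [h, Finset.smul_sum, Finset.sum_smul, smul_smul]
  exact Finset.sum_comm

theorem HasDecomp.of_shear {r : ℕ} {X Y Z : Matrix α β ℂ} (μ : ℂ)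
    (h : HasDecomp r ![X + μ • Y, Y, Z]) : HasDecomp r ![X, Y, Z] := by
  convert h.comb !![1, -μ, 0; 0, 1, 0; 0, 0, 1] with k
  fin_cases k <;> simp [Fin.sum_univ_three]

omit [Fintype ι] in
theorem HasDecomp.extend {r : ℕ} {A : γ → Matrix ι ι ℂ} {n : ι}
    (h : HasDecomp r fun k =>
      (A k).submatrix (Subtype.val : {i // i ≠ n} → ι) (Subtype.val : {i // i ≠ n} → ι))
    (hrow : ∀ k j, A k n j = 0) (hcol : ∀ k i, A k i n = 0) : HasDecomp r A := by
  obtain ⟨a, b, c, h⟩ := h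
  refine ⟨fun l i => if hi : i ≠ n then a l ⟨i, hi⟩ else 0,
    fun l i => if hi : i ≠ n then b l ⟨i, hi⟩ else 0, c, fun k => ?_⟩
  ext i j
  by_cases hi : i = n
  · subst hi; simp [hrow, Matrix.sum_apply, vecMulVec_apply]
  by_cases hj : j = n
  · subst hj; simp [hcol, Matrix.sum_apply, vecMulVec_apply]
  have := congrFun₂ (h k) ⟨i, hi⟩ ⟨j, hj⟩
  simpa [Matrix.sum_apply, vecMulVec_apply, hi, hj] using this

/-- The pencil `z • M₁ - M₂` has nonsingular leading matrix and pairwise distinct eigenvalues. -/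
def HasDistinctEigenvalues (M₁ M₂ : Matrix ι ι ℂ) : Prop :=
  M₁.det ≠ 0 ∧ ∃ e : ι → ℂ, Function.Injective e ∧ ∀ i, (e i • M₁ - M₂).det = 0

theorem HasDistinctEigenvalues.hasDecomp {M₁ M₂ : Matrix ι ι ℂ}
    (h : HasDistinctEigenvalues M₁ M₂) :
    HasDecomp (Fintype.card ι) ![M₁, M₂, 0] := by
  obtain ⟨h1, e, he, h2⟩ := h
  have hv : ∀ i, ∃ v ≠ 0, (e i • M₁ - M₂) *ᵥ v = 0 := fun i =>
    Matrix.exists_mulVec_eq_zero_iff.mpr (h2 i)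
  choose v hv0 hv using hv
  have hli : LinearIndependent ℂ v := by
    refine Module.End.eigenvectors_linearIndependent' (Matrix.toLin' (M₁⁻¹ * M₂)) e he v
      fun i => ⟨Module.End.mem_eigenspace_iff.mpr ?_, hv0 i⟩
    have := hv i
    rw [Matrix.sub_mulVec, sub_eq_zero] at this
    rw [Matrix.toLin'_apply, ← Matrix.mulVec_mulVec, ← this, Matrix.smul_mulVec,
      Matrix.mulVec_smul, Matrix.mulVec_mulVec, Matrix.nonsing_inv_mul _ h1.isUnit,
      Matrix.one_mulVec]
  let W : Matrix ι ι ℂ := (Matrix.of v)ᵀ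
  have hW : W.det ≠ 0 := by
    rw [Matrix.det_transpose]
    have := Matrix.linearIndependent_rows_iff_isUnit (A := Matrix.of v).mp hli
    exact ((Matrix.isUnit_iff_isUnit_det _).mp this).ne_zero
  have hMW : M₂ * W = M₁ * W * diagonal e := by
    ext i j
    have := congrFun (hv j) i
    rw [Matrix.sub_mulVec, Pi.sub_apply, Pi.zero_apply, sub_eq_zero, Matrix.smul_mulVec] at this
    rw [Matrix.mul_diagonal]
    simpa [W, Matrix.mul_apply, Matrix.mulVec, dotProduct, mul_comm] using this.symm
  refine HasDecomp.of_mul (P := 1) (Q := W) (by simp) hW ?_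
  refine HasDecomp.of_fintype (κ := ι) (fun i => (M₁ * W).col i) (fun i => Pi.single i 1)
    (fun i => ![1, e i, 0]) (fun k => ?_) rfl
  fin_cases k
  · ext i j; simp [Matrix.sum_apply, vecMulVec_apply, Pi.single_apply]
  · ext i j
    simp [Matrix.sum_apply, vecMulVec_apply, Pi.single_apply, hMW, mul_comm]
  · simp

theorem exists_root_norm_sub_lt {p : ℂ[X]} (hp : p.Monic) {z : ℂ} {ε : ℝ} (hε : 0 ≤ ε)
    (h : ‖p.eval z‖ < ε ^ p.natDegree) : ∃ μ, p.eval μ = 0 ∧ ‖z - μ‖ < ε := by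
  by_contra! hc
  have key : ∀ s : Multiset ℂ, (∀ μ ∈ s, ε ≤ ‖z - μ‖) →
      ε ^ s.card ≤ ‖(s.map fun μ => z - μ).prod‖ := by
    intro s
    induction s using Multiset.induction with
    | empty => simp
    | cons a s ih =>
      intro hs
      rw [Multiset.card_cons, pow_succ', Multiset.map_cons, Multiset.prod_cons, norm_mul]
      exact mul_le_mul (hs a (by simp)) (ih fun μ hμ => hs μ (Multiset.mem_cons_of_mem hμ))
        (by positivity) (by positivity)
  have hs := IsAlgClosed.splits p
  have := key p.roots fun μ hμ => hc μ (Polynomial.isRoot_of_mem_roots hμ)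
  rw [← hs.eval_eq_prod_roots_of_monic hp, ← hs.natDegree_eq_card_roots] at this
  exact absurd h this.not_gt

theorem HasDistinctEigenvalues.eventually {M₁ M₂ : ℂ → Matrix ι ι ℂ} (c₁ : Continuous M₁)
    (c₂ : Continuous M₂) (h : HasDistinctEigenvalues (M₁ 0) (M₂ 0)) :
    ∀ᶠ t in 𝓝 0, HasDistinctEigenvalues (M₁ t) (M₂ t) := by
  obtain ⟨h1, e, he, h2⟩ := h
  obtain ⟨ε, hε, hsep⟩ : ∃ ε > 0, ∀ i j, i ≠ j → 2 * ε ≤ ‖e i - e j‖ := by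
    have : ∀ᶠ ε in 𝓝[>] (0 : ℝ), ∀ i j, i ≠ j → 2 * ε ≤ ‖e i - e j‖ := by
      rw [eventually_all]; intro i
      rw [eventually_all]; intro j
      by_cases hij : i = j
      · simp [hij]
      have hpos : 0 < ‖e i - e j‖ := norm_pos_iff.mpr (sub_ne_zero.mpr (he.ne hij))
      filter_upwards [Ioo_mem_nhdsGT (half_pos hpos)] with ε hε _
      linarith [hε.2]
    obtain ⟨ε, h, hpos⟩ := (this.and self_mem_nhdsWithin).exists
    exact ⟨ε, hpos, h⟩
  have hdet : ∀ᶠ t in 𝓝 0, (M₁ t).det ≠ 0 := c₁.matrix_det.continuousAt.eventually_ne h1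
  have hsmall : ∀ᶠ t in 𝓝 0, ∀ i,
      ‖((M₁ t).det)⁻¹ * (e i • M₁ t - M₂ t).det‖ < ε ^ Fintype.card ι := by
    rw [eventually_all]; intro i
    have hc : ContinuousAt (fun t => ‖((M₁ t).det)⁻¹ * (e i • M₁ t - M₂ t).det‖) 0 :=
      ((c₁.matrix_det.continuousAt.inv₀ h1).mul
        ((c₁.const_smul (e i)).sub c₂).matrix_det.continuousAt).norm
    refine hc.eventually_lt_const ?_
    simp only [h2 i, mul_zero, norm_zero]
    positivity
  filter_upwards [hdet, hsmall] with t ht hs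
  have hev : ∀ z, ((M₁ t)⁻¹ * M₂ t).charpoly.eval z = ((M₁ t).det)⁻¹ * (z • M₁ t - M₂ t).det := by
    intro z
    rw [Matrix.eval_charpoly, ← Ring.inverse_eq_inv', ← Matrix.det_nonsing_inv, ← Matrix.det_mul,
      Matrix.mul_sub, Matrix.mul_smul, Matrix.nonsing_inv_mul _ ht.isUnit]
    simp [Matrix.smul_one_eq_diagonal]
  have hroot : ∀ i, ∃ μ, ((M₁ t)⁻¹ * M₂ t).charpoly.eval μ = 0 ∧ ‖e i - μ‖ < ε := fun i =>
    exists_root_norm_sub_lt (Matrix.charpoly_monic _) hε.le (by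
      rw [Matrix.charpoly_natDegree_eq_dim, hev]; exact hs i)
  choose μ hμ hclose using hroot
  refine ⟨ht, μ, fun i j hij => ?_, fun i => ?_⟩
  · by_contra hne
    have h3 : ‖e i - e j‖ ≤ ‖e i - μ i‖ + ‖e j - μ j‖ := by
      rw [hij, norm_sub_rev (e j)]
      exact norm_sub_le_norm_sub_add_norm_sub _ _ _
    linarith [hsep i j hne, hclose i, hclose j]
  · have := hμ i
    rw [hev] at this
    exact (mul_eq_zero.mp this).resolve_left (inv_ne_zero ht)

theorem hasDecomp_diagonal (c : ι → γ → ℂ) {n : ι} (hc : ∀ k, c n k = 0) :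
    HasDecomp (Fintype.card ι - 1) (fun k => diagonal fun i => c i k) := by
  refine HasDecomp.extend (n := n) ?_ (fun k j => ?_) (fun k i => ?_)
  · refine HasDecomp.of_fintype (κ := {i // i ≠ n}) (fun i => Pi.single i 1)
      (fun i => Pi.single i 1) (fun i => c i.1) (fun k => ?_) (by simp)
    ext i j
    by_cases hij : i = j
    · subst hij
      simp [Matrix.sum_apply, vecMulVec_apply, Pi.single_apply]
    · have : i.1 ≠ j.1 := fun h => hij (Subtype.ext h)
      simp [Matrix.sum_apply, vecMulVec_apply, Pi.single_apply, hij, this]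
  · by_cases h : n = j <;> simp [h, ← hc k]
  · by_cases h : i = n <;> simp [h, hc]

/-- The rows of `X` indexed by `p` are scaled by `t` and perturbed by those of `diagonal d`. -/
def blockPencil (p : ι → Prop) [DecidablePred p] (d : ι → ℂ) (X : Matrix ι ι ℂ) (t : ℂ) :
    Matrix ι ι ℂ :=
  of fun i j => if p i then diagonal d i j + t * X i j else X i j

omit [Fintype ι] in
theorem continuous_blockPencil (p : ι → Prop) [DecidablePred p] (d : ι → ℂ) (X : Matrix ι ι ℂ) :
    Continuous (blockPencil p d X) := by
  refine continuous_matrix fun i j => ?_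
  by_cases h : p i <;> simp only [blockPencil, of_apply, h, if_true, if_false] <;> fun_prop

theorem diagonal_mul_blockPencil (p : ι → Prop) [DecidablePred p] (d : ι → ℂ)
    (X : Matrix ι ι ℂ) {t : ℂ} (ht : t ≠ 0) :
    diagonal (fun i => if p i then t⁻¹ else 1) * blockPencil p d X t =
      X + diagonal fun i => if p i then t⁻¹ * d i else 0 := by
  ext i j
  rw [Matrix.diagonal_mul, Matrix.add_apply]
  by_cases hij : i = j
  · subst hij
    by_cases h : p i <;> simp [blockPencil, h]
    field_simp
    ring
  · by_cases h : p i <;> simp [blockPencil, h, hij, ht]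

theorem hasDecomp_of_blockPencil {X Y : Matrix ι ι ℂ} {D d : ι → ℂ} {p : ι → Prop}
    [DecidablePred p] {n : ι} (hn : ¬ p n) (hD : D n = 0)
    (h : HasDistinctEigenvalues (blockPencil p 1 X 0) (blockPencil p d Y 0)) :
    HasDecomp (Fintype.card ι + (Fintype.card ι - 1)) ![X, Y, diagonal D] := by
  have hev := h.eventually (continuous_blockPencil p 1 X) (continuous_blockPencil p d Y)
  obtain ⟨t, hgood, ht⟩ :=
    ((hev.filter_mono nhdsWithin_le_nhds).and (self_mem_nhdsWithin (s := {(0 : ℂ)}ᶜ))).exists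
  have h1 := hgood.hasDecomp.mul (diagonal fun i => if p i then t⁻¹ else 1) (1 : Matrix ι ι ℂ)
  have h2 := hasDecomp_diagonal (n := n)
    (fun i => ![-(if p i then t⁻¹ * 1 else 0), -(if p i then t⁻¹ * d i else 0), D i])
    (fun k => by fin_cases k <;> simp [hn, hD])
  convert h1.add h2 with k
  have e1 := diagonal_mul_blockPencil p 1 X ht
  have e2 := diagonal_mul_blockPencil p d Y ht
  fin_cases k
  · simp [e1, ← Matrix.diagonal_neg]
  · simp [e2, ← Matrix.diagonal_neg]
  · simp

omit [DecidableEq ι] in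
theorem exists_injective_eq (n : ι) (x : ℂ) : ∃ e : ι → ℂ, Function.Injective e ∧ e n = x := by
  obtain ⟨f⟩ : Nonempty (ι ↪ ℂ) := ⟨(Fintype.equivFin ι).toEmbedding.trans
    (Fin.valEmbedding.trans (Infinite.natEmbedding ℂ))⟩
  exact ⟨Equiv.swap (f n) x ∘ f, (Equiv.injective _).comp f.injective, by simp⟩

omit [DecidableEq ι] in
theorem exists_injective_eq_eq {a n : ι} (han : a ≠ n) {x y : ℂ} (hxy : x ≠ y) :
    ∃ e : ι → ℂ, Function.Injective e ∧ e a = x ∧ e n = y := by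
  obtain ⟨f, hf, hfn⟩ := exists_injective_eq n y
  refine ⟨Equiv.swap (f a) x ∘ f, (Equiv.injective _).comp hf, by simp, ?_⟩
  rw [Function.comp_apply, Equiv.swap_apply_of_ne_of_ne (hf.ne han.symm) (hfn ▸ hxy.symm), hfn]

theorem hasDecomp_of_corner_ne_zero {X Y : Matrix ι ι ℂ} {D : ι → ℂ} {n : ι} (hD : D n = 0)
    (hX : X n n ≠ 0) :
    HasDecomp (Fintype.card ι + (Fintype.card ι - 1)) ![X, Y, diagonal D] := by
  obtain ⟨e, he, hen⟩ := exists_injective_eq n (Y n n / X n n)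
  refine hasDecomp_of_blockPencil (p := (· ≠ n)) (n := n) (d := e) (by simp) hD ⟨?_, e, he, ?_⟩
  · rw [Ne, ← Matrix.exists_mulVec_eq_zero_iff]
    rintro ⟨w, hw0, hw⟩
    have hp : ∀ i, i ≠ n → w i = 0 := fun i hi => by
      have := congrFun hw i
      simpa [Matrix.mulVec, dotProduct, blockPencil, hi, Matrix.diagonal_apply] using this
    have hn := congrFun hw n
    rw [Matrix.mulVec, dotProduct, Finset.sum_eq_single n (by
      intro j _ hj; simp [hp j hj]) (by simp)] at hn
    apply hw0
    ext i
    by_cases hi : i = n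
    · subst hi; simpa [blockPencil, hX] using hn
    · exact hp i hi
  · intro i
    by_cases hi : i = n
    · subst hi
      refine Matrix.det_eq_zero_of_column_eq_zero i fun j => ?_
      by_cases hj : j = i
      · subst hj; simp [blockPencil, hen, hX]
      · simp [blockPencil, hj]
    · refine Matrix.det_eq_zero_of_row_eq_zero i fun j => ?_
      by_cases hj : i = j
      · subst hj; simp [blockPencil, hi]
      · simp [blockPencil, hi, hj]

theorem hasDecomp_of_border {X Y : Matrix ι ι ℂ} {D : ι → ℂ} {a n : ι} (han : a ≠ n)
    (hD : D n = 0) (hXn : X n n = 0) (hYn : Y n n = 0) (hr : X n a ≠ 0) (hc : X a n ≠ 0)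
    (hK : X n a * Y a n - Y n a * X a n ≠ 0) :
    HasDecomp (Fintype.card ι + (Fintype.card ι - 1)) ![X, Y, diagonal D] := by
  have hne : Y n a / X n a ≠ Y a n / X a n := by
    rw [Ne, div_eq_div_iff hr hc]
    intro h
    exact hK (by linear_combination -h)
  obtain ⟨e, he, hea, hen⟩ := exists_injective_eq_eq han hne
  have hna := han.symm
  refine hasDecomp_of_blockPencil (p := fun i => i ≠ a ∧ i ≠ n) (n := n) (d := e) (by simp) hD
    ⟨?_, e, he, ?_⟩
  · rw [Ne, ← Matrix.exists_mulVec_eq_zero_iff]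
    rintro ⟨w, hw0, hw⟩
    have hp : ∀ i, i ≠ a → i ≠ n → w i = 0 := fun i hi hi' => by
      have := congrFun hw i
      simpa [Matrix.mulVec, dotProduct, blockPencil, hi, hi', Matrix.diagonal_apply] using this
    have hwa : w a = 0 := by
      have hn := congrFun hw n
      rw [Matrix.mulVec, dotProduct, Finset.sum_eq_single a (by
        intro j _ hj
        by_cases hjn : j = n
        · subst hjn; simp [blockPencil, hXn]
        · simp [hp j hj hjn]) (by simp)] at hn
      simpa [blockPencil, hr] using hn
    have hwn : w n = 0 := by
      have ha := congrFun hw a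
      rw [Matrix.mulVec, dotProduct, Finset.sum_eq_single n (by
        intro j _ hj
        by_cases hja : j = a
        · simp [hja, hwa]
        · simp [hp j hja hj]) (by simp)] at ha
      simpa [blockPencil, hc] using ha
    apply hw0
    ext i
    by_cases hi : i = a
    · rw [hi, hwa]; rfl
    by_cases hi' : i = n
    · rw [hi', hwn]; rfl
    exact hp i hi hi'
  · intro i
    by_cases hi : i = n
    · subst hi
      refine Matrix.det_eq_zero_of_column_eq_zero i fun j => ?_
      by_cases hj : j = i
      · subst hj; simp [blockPencil, hXn, hYn]
      by_cases hja : j = a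
      · subst hja; simp [blockPencil, hen, hc]
      · simp [blockPencil, hj, hja]
    by_cases hia : i = a
    · subst hia
      set N := e i • blockPencil (fun j => j ≠ i ∧ j ≠ n) 1 X 0 -
        blockPencil (fun j => j ≠ i ∧ j ≠ n) e Y 0 with hN
      have hcn : N i n ≠ 0 := by
        simp only [hN, Matrix.sub_apply, Matrix.smul_apply, blockPencil, of_apply]
        simp only [ne_eq, not_true_eq_false, false_and, if_false, hea, smul_eq_mul]
        field_simp
        intro h
        exact hK (by linear_combination -h)
      rw [← Matrix.exists_mulVec_eq_zero_iff]
      refine ⟨Pi.single i (N i n) - Pi.single n (N i i), fun h => hcn ?_, ?_⟩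
      · simpa [han] using congrFun h i
      · ext j
        rw [Matrix.mulVec_sub, Pi.sub_apply]
        simp only [Matrix.mulVec_single, Pi.smul_apply, Matrix.col_apply]
        by_cases hj : j = i
        · subst hj; simp [mul_comm]
        by_cases hjn : j = n
        · subst hjn
          simp [hN, blockPencil, hXn, hYn, hea, hr]
        · simp [hN, blockPencil, hj, hjn]
    · refine Matrix.det_eq_zero_of_row_eq_zero i fun j => ?_
      by_cases hj : i = j
      · subst hj; simp [blockPencil, hi, hia]
      · simp [blockPencil, hi, hj, hia]

/-- A single transvection on each side fixes a diagonal matrix and makes some diagonal entry of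
the antisymmetrized border nonzero. -/
theorem hasDecomp_of_border_ne_zero {X Y : Matrix ι ι ℂ} {D : ι → ℂ} {n : ι} (hD : D n = 0)
    (hXn : X n n = 0) (hYn : Y n n = 0) {a b : ι}
    (hK : X n a * Y b n - Y n a * X b n ≠ 0) :
    HasDecomp (Fintype.card ι + (Fintype.card ι - 1)) ![X, Y, diagonal D] := by
  have diagCase : ∀ {X Y : Matrix ι ι ℂ} {a : ι}, X n n = 0 → Y n n = 0 →
      X n a * Y a n - Y n a * X a n ≠ 0 →
      HasDecomp (Fintype.card ι + (Fintype.card ι - 1)) ![X, Y, diagonal D] := by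
    intro X Y a hXn hYn hK
    have han : a ≠ n := by rintro rfl; simp [hXn, hYn] at hK
    obtain ⟨μ, hμ⟩ : ∃ μ : ℂ, μ ∉ ({-X n a / Y n a, -X a n / Y a n} : Finset ℂ) :=
      Infinite.exists_notMem_finset _
    simp only [Finset.mem_insert, Finset.mem_singleton, not_or] at hμ
    refine HasDecomp.of_shear μ (hasDecomp_of_border han hD (by simp [hXn, hYn]) hYn ?_ ?_ ?_)
    · rw [Matrix.add_apply, Matrix.smul_apply, smul_eq_mul]
      intro h
      by_cases h0 : Y n a = 0
      · rw [h0, mul_zero, add_zero] at h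
        simp [h, h0] at hK
      · exact hμ.1 (by rw [eq_div_iff h0]; linear_combination h)
    · rw [Matrix.add_apply, Matrix.smul_apply, smul_eq_mul]
      intro h
      by_cases h0 : Y a n = 0
      · rw [h0, mul_zero, add_zero] at h
        simp [h, h0] at hK
      · exact hμ.2 (by rw [eq_div_iff h0]; linear_combination h)
    · simp only [Matrix.add_apply, Matrix.smul_apply, smul_eq_mul]
      intro h
      exact hK (by linear_combination h)
  by_cases hd : ∃ c, X n c * Y c n - Y n c * X c n ≠ 0
  · obtain ⟨c, hc⟩ := hd
    exact diagCase hXn hYn hc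
  push Not at hd
  have hab : a ≠ b := by rintro rfl; exact hK (hd a)
  have han : a ≠ n := by rintro rfl; simp [hXn, hYn] at hK
  have hbn : b ≠ n := by rintro rfl; simp [hXn, hYn] at hK
  obtain ⟨s, u, hDsu, hsu⟩ : ∃ s u : ℂ, s * D b + u * D a = 0 ∧ (s = 1 ∨ s = 0 ∧ u = 1) := by
    by_cases h : D a = 0
    · exact ⟨0, 1, by simp [h], Or.inr ⟨rfl, rfl⟩⟩
    · exact ⟨1, -D b / D a, by field_simp; ring, Or.inl rfl⟩
  refine HasDecomp.of_mul (P := transvection a b s) (Q := transvection a b u)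
    (by simp [det_transvection_of_ne _ _ hab]) (by simp [det_transvection_of_ne _ _ hab]) ?_
  have hdiag : transvection a b s * diagonal D * transvection a b u = diagonal D := by
    ext i j
    by_cases hj : j = b
    · subst hj
      rw [mul_transvection_apply_same]
      by_cases hi : i = a
      · subst hi
        simp only [transvection_mul_apply_same]
        simp [hab, hab.symm]
        linear_combination hDsu
      · rw [transvection_mul_apply_of_ne _ _ _ _ hi, transvection_mul_apply_of_ne _ _ _ _ hi]
        simp [hi]
    · rw [mul_transvection_apply_of_ne _ _ _ _ hj]
      by_cases hi : i = a
      · subst hi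
        rw [transvection_mul_apply_same]
        simp [Ne.symm hj]
      · rw [transvection_mul_apply_of_ne _ _ _ _ hi]
  have hnn : ∀ M : Matrix ι ι ℂ, (transvection a b s * M * transvection a b u) n n = M n n :=
    fun M => by
      rw [mul_transvection_apply_of_ne _ _ _ _ hbn.symm,
        transvection_mul_apply_of_ne _ _ _ _ han.symm]
  have hra : ∀ M : Matrix ι ι ℂ, (transvection a b s * M * transvection a b u) n a = M n a :=
    fun M => by
      rw [mul_transvection_apply_of_ne _ _ _ _ hab, transvection_mul_apply_of_ne _ _ _ _ han.symm]
  have hrb : ∀ M : Matrix ι ι ℂ,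
      (transvection a b s * M * transvection a b u) n b = M n b + u * M n a := fun M => by
    rw [mul_transvection_apply_same, transvection_mul_apply_of_ne _ _ _ _ han.symm,
      transvection_mul_apply_of_ne _ _ _ _ han.symm]
  have hca : ∀ M : Matrix ι ι ℂ,
      (transvection a b s * M * transvection a b u) a n = M a n + s * M b n := fun M => by
    rw [mul_transvection_apply_of_ne _ _ _ _ hbn.symm, transvection_mul_apply_same]
  have hcb : ∀ M : Matrix ι ι ℂ, (transvection a b s * M * transvection a b u) b n = M b n :=
    fun M => by
      rw [mul_transvection_apply_of_ne _ _ _ _ hbn.symm,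
        transvection_mul_apply_of_ne _ _ _ _ hab.symm]
  suffices h : HasDecomp (Fintype.card ι + (Fintype.card ι - 1))
      ![transvection a b s * X * transvection a b u,
        transvection a b s * Y * transvection a b u, diagonal D] by
    convert h using 1
    ext1 k
    fin_cases k
    · rfl
    · rfl
    · exact hdiag
  rcases hsu with rfl | ⟨rfl, rfl⟩
  · refine diagCase (a := a) (by rw [hnn, hXn]) (by rw [hnn, hYn]) ?_
    rw [hra, hra, hca, hca]
    intro h
    exact hK (by linear_combination h - hd a)
  · refine diagCase (a := b) (by rw [hnn, hXn]) (by rw [hnn, hYn]) ?_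
    rw [hrb, hrb, hcb, hcb]
    intro h
    exact hK (by linear_combination h - hd b)

omit [Fintype ι] in
/-- The row `n` and the column `n` of three matrices take two simple tensors. -/
theorem hasDecomp_two_of_border {X Y Z : Matrix ι ι ℂ} {n : ι} (hXn : X n n = 0)
    (hYn : Y n n = 0) (hZr : ∀ j, Z n j = 0) (hZc : ∀ i, Z i n = 0)
    (hK : ∀ a b, X n a * Y b n - Y n a * X b n = 0)
    (hother : ∀ i j, i ≠ n → j ≠ n → X i j = 0 ∧ Y i j = 0 ∧ Z i j = 0) :
    HasDecomp 2 ![X, Y, Z] := by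
  have hZ : ∀ i j, Z i j = 0 := fun i j => by
    by_cases hi : i = n
    · exact hi ▸ hZr j
    by_cases hj : j = n
    · exact hj ▸ hZc i
    exact (hother i j hi hj).2.2
  by_cases hc : ∀ i, X i n = 0 ∧ Y i n = 0
  · have h0 : ∀ i j, i ≠ n → X i j = 0 ∧ Y i j = 0 := fun i j hi => by
      by_cases hj : j = n
      · exact hj ▸ hc i
      · exact ⟨(hother i j hi hj).1, (hother i j hi hj).2.1⟩
    have h1 : HasDecomp 1 ![X, 0, 0] := hasDecomp_one_three 1 0 0 (Pi.single n 1) (X n)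
      (fun i j => by
        by_cases hi : i = n
        · subst hi; simp
        · simp [hi, h0]) (by simp) (by simp)
    have h2 : HasDecomp 1 ![0, Y, Z] := hasDecomp_one_three 0 1 0 (Pi.single n 1) (Y n)
      (by simp) (fun i j => by
        by_cases hi : i = n
        · subst hi; simp
        · simp [hi, h0]) (by simp [hZ])
    simpa using h1.add_three h2
  by_cases hr : ∀ j, X n j = 0 ∧ Y n j = 0
  · have h0 : ∀ i j, j ≠ n → X i j = 0 ∧ Y i j = 0 := fun i j hj => by
      by_cases hi : i = n
      · exact hi ▸ hr j
      · exact ⟨(hother i j hi hj).1, (hother i j hi hj).2.1⟩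
    have h1 : HasDecomp 1 ![X, 0, 0] := hasDecomp_one_three 1 0 0 (X · n) (Pi.single n 1)
      (fun i j => by
        by_cases hj : j = n
        · subst hj; simp
        · simp [hj, h0]) (by simp) (by simp)
    have h2 : HasDecomp 1 ![0, Y, Z] := hasDecomp_one_three 0 1 0 (Y · n) (Pi.single n 1)
      (by simp) (fun i j => by
        by_cases hj : j = n
        · subst hj; simp
        · simp [hj, h0]) (by simp [hZ])
    simpa using h1.add_three h2
  obtain ⟨a, ha⟩ : ∃ a, ¬ (X n a = 0 ∧ Y n a = 0) := by simpa using hr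
  obtain ⟨b, hb⟩ : ∃ b, ¬ (X b n = 0 ∧ Y b n = 0) := by simpa using hc
  obtain ⟨μ, ν, w, v, hXw, hYw, hXv, hYv⟩ : ∃ (μ ν : ℂ) (w v : ι → ℂ), (∀ j, X n j = μ * w j) ∧
      (∀ j, Y n j = ν * w j) ∧ (∀ i, X i n = μ * v i) ∧ (∀ i, Y i n = ν * v i) := by
    by_cases h0 : X n a = 0
    · have hYa : Y n a ≠ 0 := fun h => ha ⟨h0, h⟩
      have hX : ∀ i, X i n = 0 := fun i => by
        have := hK a i
        rw [h0] at this
        simpa [hYa] using this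
      have hYb : Y b n ≠ 0 := fun h => hb ⟨hX b, h⟩
      refine ⟨0, 1, Y n, fun i => Y i n, fun j => ?_, by simp, by simp [hX], by simp⟩
      have := hK j b
      rw [hX b] at this
      simpa [hYb] using this
    · have hY : ∀ i, Y i n = Y n a / X n a * X i n := fun i => by
        field_simp
        linear_combination hK a i
      have hXb : X b n ≠ 0 := fun h => hb ⟨h, by rw [hY, h, mul_zero]⟩
      refine ⟨1, Y n a / X n a, X n, fun i => X i n, by simp, fun j => ?_, by simp, hY⟩
      apply mul_right_cancel₀ hXb
      have := hK j b
      rw [hY b] at this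
      linear_combination -this
  let row (M : Matrix ι ι ℂ) : Matrix ι ι ℂ := of fun i j => if i = n then M i j else 0
  let col (M : Matrix ι ι ℂ) : Matrix ι ι ℂ := of fun i j => if i = n then 0 else M i j
  have hsum : ∀ M, row M + col M = M := fun M => by
    ext i j
    by_cases hi : i = n <;> simp [row, col, hi]
  have h1 : HasDecomp 1 ![row X, row Y, row Z] := by
    refine hasDecomp_one_three μ ν 0 (Pi.single n 1) w (fun i j => ?_) (fun i j => ?_)
      (by simp [row, hZ]) <;>
    · by_cases hi : i = n
      · subst hi; simp [row, hXw, hYw]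
      · simp [row, hi]
  have h2 : HasDecomp 1 ![col X, col Y, col Z] := by
    refine hasDecomp_one_three μ ν 0 v (Pi.single n 1) (fun i j => ?_) (fun i j => ?_)
      (by simp [col, hZ]) <;>
    · by_cases hj : j = n
      · by_cases hi : i = n
        · subst hi hj; simp [col, ← hXv, ← hYv, hXn, hYn]
        · subst hj; simp [col, hi, hXv, hYv]
      · by_cases hi : i = n
        · simp [col, hi, hj]
        · simp [col, hi, hj, hother i j hi hj]
  simpa only [hsum] using h1.add_three h2

theorem hasDecomp_of_det_eq_zero {m : ℕ} (hm : Fintype.card ι = m + 2)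
    (ih : ∀ (n : ι) (A : Fin 3 → Matrix {i // i ≠ n} {i // i ≠ n} ℂ), HasDecomp (2 * m + 1) A)
    (X Y Z : Matrix ι ι ℂ) (hZ : Z.det = 0) : HasDecomp (2 * (m + 1) + 1) ![X, Y, Z] := by
  obtain ⟨L, L', D, hLD⟩ := Pivot.exists_list_transvec_mul_mul_list_transvec_eq_diagonal Z
  set P := (L.map TransvectionStruct.toMatrix).prod with hPdef
  set Q := (L'.map TransvectionStruct.toMatrix).prod with hQdef
  have hP : P.det = 1 := TransvectionStruct.det_toMatrix_prod L
  have hQ : Q.det = 1 := TransvectionStruct.det_toMatrix_prod L'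
  obtain ⟨n, hn⟩ : ∃ n, D n = 0 := by
    have := congrArg Matrix.det hLD
    rw [Matrix.det_mul, Matrix.det_mul, hP, hQ, hZ, Matrix.det_diagonal] at this
    simpa [Finset.prod_eq_zero_iff] using this.symm
  refine HasDecomp.of_mul (P := P) (Q := Q) (by simp [hP]) (by simp [hQ]) ?_
  suffices h : ∀ X Y, HasDecomp (2 * (m + 1) + 1) ![X, Y, diagonal D] by
    convert h (P * X * Q) (P * Y * Q) using 1
    ext1 k
    fin_cases k
    · rfl
    · rfl
    · exact hLD
  clear X Y
  intro X Y
  have hcard : Fintype.card ι + (Fintype.card ι - 1) = 2 * (m + 1) + 1 := by omega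
  by_cases hX : X n n = 0; swap
  · exact hcard ▸ hasDecomp_of_corner_ne_zero hn hX
  by_cases hY : Y n n = 0; swap
  · exact hcard ▸ HasDecomp.of_shear 1 (hasDecomp_of_corner_ne_zero hn (by simpa [hX] using hY))
  by_cases hK : ∀ a b, X n a * Y b n - Y n a * X b n = 0; swap
  · push Not at hK
    obtain ⟨a, b, hab⟩ := hK
    exact hcard ▸ hasDecomp_of_border_ne_zero hn hX hY hab
  let B (M : Matrix ι ι ℂ) : Matrix ι ι ℂ := of fun i j => if i = n ∨ j = n then M i j else 0
  let I (M : Matrix ι ι ℂ) : Matrix ι ι ℂ := of fun i j => if i = n ∨ j = n then 0 else M i j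
  have h1 : HasDecomp 2 ![B X, B Y, B (diagonal D)] := by
    refine hasDecomp_two_of_border (n := n) (by simp [B, hX]) (by simp [B, hY]) (fun j => ?_)
      (fun i => ?_) (by simpa [B] using hK) (fun i j hi hj => by simp [B, hi, hj])
    · by_cases h : n = j
      · simp [B, ← h, hn]
      · simp [B, h]
    · by_cases h : i = n <;> simp [B, h, hn]
  have hrow : ∀ M j, I M n j = 0 := fun M j => by simp [I]
  have hcol : ∀ M i, I M i n = 0 := fun M i => by simp [I]
  have h2 : HasDecomp (2 * m + 1) ![I X, I Y, I (diagonal D)] :=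
    HasDecomp.extend (n := n) (ih n _)
      (fun k j => by fin_cases k; exacts [hrow X j, hrow Y j, hrow _ j])
      (fun k i => by fin_cases k; exacts [hcol X i, hcol Y i, hcol _ i])
  have hsum : ∀ M, B M + I M = M := fun M => by
    ext i j
    by_cases hi : i = n ∨ j = n <;> simp [B, I, hi]
  have h := h1.add_three h2
  rwa [hsum, hsum, hsum, show 2 + (2 * m + 1) = 2 * (m + 1) + 1 by ring] at h

theorem exists_det_sub_smul_eq_zero [Nonempty ι] (Y : Matrix ι ι ℂ) {Z : Matrix ι ι ℂ}
    (hZ : Z.det ≠ 0) : ∃ z : ℂ, (Y - z • Z).det = 0 := by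
  obtain ⟨z, hz⟩ := IsAlgClosed.exists_root (Z⁻¹ * Y).charpoly (by
    rw [Matrix.charpoly_degree_eq_dim]
    exact_mod_cast Fintype.card_ne_zero)
  refine ⟨z, ?_⟩
  rw [Polynomial.IsRoot.def, Matrix.eval_charpoly] at hz
  have : Y - z • Z = -(Z * (Matrix.scalar ι z - Z⁻¹ * Y)) := by
    rw [Matrix.mul_sub, Matrix.mul_nonsing_inv_cancel_left _ _ hZ.isUnit]
    ext i j
    simp [mul_comm]
  rw [this, Matrix.det_neg, Matrix.det_mul, hz, mul_zero, mul_zero]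

theorem hasDecomp_three (m : ℕ) : ∀ (ι : Type) [Fintype ι] [DecidableEq ι],
    Fintype.card ι = m + 1 → ∀ A : Fin 3 → Matrix ι ι ℂ, HasDecomp (2 * m + 1) A := by
  induction m with
  | zero =>
    intro ι _ _ hι A
    obtain ⟨x, hx⟩ := Fintype.card_eq_one_iff.mp hι
    convert hasDecomp_vecMulVec (fun k => A k x x) (fun _ => 1) (fun _ => 1) with k
    ext i j
    simp [hx i, hx j, vecMulVec_apply]
  | succ m ih =>
    intro ι _ _ hι A
    have ih' : ∀ (n : ι) (A : Fin 3 → Matrix {i // i ≠ n} {i // i ≠ n} ℂ),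
        HasDecomp (2 * m + 1) A := fun n => ih _ (by simp [hι])
    by_cases hZ : (A 2).det = 0
    · convert hasDecomp_of_det_eq_zero hι ih' (A 0) (A 1) (A 2) hZ using 1
      ext1 k
      fin_cases k <;> rfl
    · have : Nonempty ι := Fintype.card_pos_iff.mp (by omega)
      obtain ⟨z, hz⟩ := exists_det_sub_smul_eq_zero (A 1) hZ
      convert (hasDecomp_of_det_eq_zero hι ih' (A 0) (A 2) _ hz).comb
        !![1, 0, 0; 0, z, 1; 0, 1, 0] with k
      fin_cases k <;> simp [Fin.sum_univ_three]

end TensorRank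

/-- For every positive integer `n`, every `n × n × 3` tensor over `ℂ` has rank
at most `2 * n - 1`. -/
theorem stmt10 {n : ℕ} (hn : 0 < n) :
    maxRank ℂ n n 3 ≤ 2 * n - 1 := by
  refine csSup_le ⟨_, 0, rfl⟩ ?_
  rintro _ ⟨A, rfl⟩
  have h := TensorRank.hasDecomp_three (n - 1) (Fin n) (by simp; omega) A
  rw [show 2 * (n - 1) + 1 = 2 * n - 1 by omega] at h
  exact Nat.sInf_le h
end

section
/- For every positive integer n, max.rank_ℂ(n,n+1,3) ≤ 2n; that is, every n×(n+1)×3 tensor over the complex numbers has rank at most 2n. -/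
open Matrix Polynomial

/-- A matrix over an algebraically closed field with separable characteristic polynomial is
diagonalizable. -/
lemma exists_diagonalization_of_separable_charpoly {K α : Type*} [Field K] [IsAlgClosed K]
    [Fintype α] [DecidableEq α] (M : Matrix α α K) (hM : M.charpoly.Separable) :
    ∃ (H : Matrix α α K) (d : α → K), IsUnit H.det ∧ M * H = H * diagonal d := by
  classical
  have hcard : Fintype.card M.charpoly.roots.toFinset = Fintype.card α := by
    rw [Fintype.card_coe, Multiset.toFinset_card_of_nodup (Polynomial.nodup_roots hM),
      ← (IsAlgClosed.splits M.charpoly).natDegree_eq_card_roots, charpoly_natDegree_eq_dim]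
  obtain ⟨e⟩ := Fintype.card_eq.mp hcard
  let d : α → K := fun i => (e.symm i : K)
  have hd : Function.Injective d := Subtype.coe_injective.comp e.symm.injective
  have hroot (i : α) : Module.End.HasEigenvalue (toLin' M) (d i) := by
    rw [Module.End.hasEigenvalue_iff_isRoot_charpoly, Matrix.charpoly_toLin']
    exact (mem_roots'.mp (Multiset.mem_toFinset.mp (e.symm i).2)).2
  choose v hv using fun i => (hroot i).exists_hasEigenvector
  have hli : LinearIndependent K v := Module.End.eigenvectors_linearIndependent' _ d hd v hv
  refine ⟨(of v)ᵀ, d, ?_, ?_⟩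
  · rw [← isUnit_iff_isUnit_det, ← linearIndependent_cols_iff_isUnit]
    exact hli
  · ext i j
    have h := congrFun (hv j).apply_eq_smul i
    rw [toLin'_apply] at h
    rw [mul_diagonal]
    simpa [mul_apply, mulVec, dotProduct, mul_comm] using h

/-- A matrix that is diagonal outside of one column has the determinant of its diagonal. -/
lemma det_eq_prod_diag_of_apply_eq_zero {R α : Type*} [CommRing R] [Fintype α] [DecidableEq α]
    (i₀ : α) (M : Matrix α α R) (hM : ∀ i j, i ≠ j → j ≠ i₀ → M i j = 0) :
    M.det = ∏ i, M i i := by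
  rw [det_apply, Finset.sum_eq_single 1]
  · simp
  · intro σ _ hσ
    obtain ⟨i, hi, hne⟩ : ∃ i, σ i ≠ i ∧ i ≠ i₀ := by
      by_contra! h
      apply hσ
      ext i
      by_cases hi : i = i₀
      · subst hi
        by_contra hne
        exact hne (σ.injective (by_contra fun h' => hne (h _ h')))
      · by_contra hne
        exact hi (h i hne)
    have h0 : ∏ j, M (σ j) j = 0 := Finset.prod_eq_zero (Finset.mem_univ i) (hM _ _ hi hne)
    exact (congrArg _ h0).trans (smul_zero _)
  · simp

/-- A vector can be mapped to any other one by a matrix with separable characteristic polynomial. -/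
lemma exists_separable_charpoly_mulVec_eq {K α : Type*} [Field K] [Infinite K]
    [Fintype α] [DecidableEq α] (x y : α → K) (hxy : x = 0 → y = 0) :
    ∃ N : Matrix α α K, N.charpoly.Separable ∧ N *ᵥ x = y := by
  obtain ⟨e⟩ : Nonempty (α ↪ K) :=
    ⟨(Fintype.equivFin α).toEmbedding.trans (Fin.valEmbedding.trans (Infinite.natEmbedding K))⟩
  by_cases hx : x = 0
  · refine ⟨diagonal e, ?_, by rw [hxy hx, hx, mulVec_zero]⟩
    rw [charpoly_diagonal, separable_prod_X_sub_C_iff]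
    exact e.injective
  obtain ⟨i₀, hi₀⟩ := Function.ne_iff.mp hx
  rw [Pi.zero_apply] at hi₀
  let G : Matrix α α K := updateCol 1 i₀ x
  have hG : IsUnit G := by
    rw [isUnit_iff_isUnit_det, isUnit_iff_ne_zero,
      det_eq_prod_diag_of_apply_eq_zero i₀ G (fun i j hij hj => by simp [G, hj, hij]),
      Finset.prod_ne_zero_iff]
    intro i _
    by_cases h : i = i₀
    · subst h; simpa [G] using hi₀
    · simp [G, h]
  obtain ⟨u, hu⟩ := hG
  let z : α → K := (↑u⁻¹ : Matrix α α K) *ᵥ y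
  let d : α → K := fun i => e i + (z i₀ - e i₀)
  let D : Matrix α α K := updateCol (diagonal d) i₀ z
  refine ⟨u.val * D * (↑u⁻¹ : Matrix α α K), ?_, ?_⟩
  · rw [coe_units_inv, charpoly_units_conj, charpoly, det_eq_prod_diag_of_apply_eq_zero i₀]
    · have h (i : α) : charmatrix D i i = X - C (d i) := by
        rw [charmatrix_apply_eq]
        by_cases h : i = i₀
        · subst h; simp [D, d]
        · simp [D, h]
      simp_rw [h]
      rw [separable_prod_X_sub_C_iff]
      exact fun a b hab => e.injective (add_right_cancel hab)
    · intro i j hij hj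
      rw [charmatrix_apply_ne _ _ _ hij]
      simp [D, hj, hij]
  · have hx' : x = u.val *ᵥ Pi.single i₀ 1 := by
      rw [hu, mulVec_single_one]
      ext i
      simp [G]
    rw [hx', mulVec_mulVec, Matrix.mul_assoc, Matrix.mul_assoc, Units.inv_mul, Matrix.mul_one,
      ← mulVec_mulVec, mulVec_single_one]
    have : D.col i₀ = z := by ext i; simp [D]
    rw [this, mulVec_mulVec, Units.mul_inv, one_mulVec]

/-- Separability of the characteristic polynomial and invertibility are stable under small
perturbations along a line. -/
lemma exists_separable_charpoly_add_smul {K α : Type*} [Field K] [CharZero K]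
    [Fintype α] [DecidableEq α] (N Z P : Matrix α α K) (hN : N.charpoly.Separable) :
    ∃ ε : K, ε ≠ 0 ∧ IsUnit (1 + ε • P).det ∧ (N + ε • Z).charpoly.Separable := by
  let F : Matrix α α K[X] := N.map C + (X : K[X]) • Z.map C
  let E : Matrix α α K[X] := 1 + (X : K[X]) • P.map C
  have hF (ε : K) : F.map (evalRingHom ε) = N + ε • Z := by ext i j; simp [F, mul_comm ε]
  have hE (ε : K) : E.map (evalRingHom ε) = 1 + ε • P := by
    ext i j
    by_cases h : i = j <;> simp [E, h, mul_comm ε]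
  let ρ : K[X] := resultant F.charpoly (derivative F.charpoly)
  have hρ (ε : K) : ρ.eval ε =
      resultant (N + ε • Z).charpoly (derivative (N + ε • Z).charpoly) := by
    rw [← coe_evalRingHom, ← resultant_map_map, ← hF, charpoly_map, ← derivative_map,
      ← charpoly_map, charpoly_natDegree_eq_dim, charpoly_natDegree_eq_dim,
      natDegree_derivative, natDegree_derivative, charpoly_natDegree_eq_dim,
      charpoly_natDegree_eq_dim]
  have hsep (ε : K) : (N + ε • Z).charpoly.Separable ↔ ρ.eval ε ≠ 0 := by
    rw [hρ, Ne, resultant_eq_zero_iff, not_and_not_right]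
    simp [(charpoly_monic _).ne_zero, Separable]
  have hdet (ε : K) : E.det.eval ε = (1 + ε • P).det := by
    rw [← coe_evalRingHom, RingHom.map_det, RingHom.mapMatrix_apply, hE]
  have hne : X * E.det * ρ ≠ 0 := by
    refine mul_ne_zero (mul_ne_zero X_ne_zero fun h => ?_) fun h => ?_
    · simpa [h] using hdet 0
    · exact (hsep 0).mp (by simpa using hN) (by rw [h, eval_zero])
  obtain ⟨ε, hε⟩ := Polynomial.exists_eval_ne_zero_of_natDegree_lt_card _ hne
    (lt_of_lt_of_le (Cardinal.natCast_lt_aleph0) (Cardinal.aleph0_le_mk K))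
  rw [eval_mul, eval_mul, eval_X, hdet] at hε
  exact ⟨ε, left_ne_zero_of_mul (left_ne_zero_of_mul hε),
    (right_ne_zero_of_mul (left_ne_zero_of_mul hε)).isUnit,
    (hsep ε).mpr (right_ne_zero_of_mul hε)⟩

/-- The Schur complement vanishes when the rank is at most the size of the invertible block. -/
lemma toBlocks₂₂_eq_of_rank_le {K α β γ : Type*} [Field K] [Fintype α] [DecidableEq α]
    [Fintype β] [Fintype γ] (M : Matrix (α ⊕ β) (α ⊕ γ) K) (hT : IsUnit M.toBlocks₁₁.det)
    (hM : M.rank ≤ Fintype.card α) :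
    M.toBlocks₂₂ = M.toBlocks₂₁ * M.toBlocks₁₁⁻¹ * M.toBlocks₁₂ := by
  ext b c
  by_contra hne
  let f : α ⊕ Unit → α ⊕ β := Sum.map id fun _ => b
  let g : α ⊕ Unit → α ⊕ γ := Sum.map id fun _ => c
  have hS : M.submatrix f g = fromBlocks M.toBlocks₁₁ (M.toBlocks₁₂.submatrix id fun _ => c)
      (M.toBlocks₂₁.submatrix (fun _ => b) id) (M.toBlocks₂₂.submatrix (fun _ => b) fun _ => c) := by
    ext (i | i) (j | j) <;> rfl
  let _ := M.toBlocks₁₁.invertibleOfIsUnitDet hT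
  have hdet : (M.submatrix f g).det ≠ 0 := by
    rw [hS, det_fromBlocks₁₁, det_unique (n := Unit)]
    refine mul_ne_zero hT.ne_zero (sub_ne_zero.mpr ?_)
    rw [invOf_eq_nonsing_inv]
    exact hne
  have h := (rank_of_det_ne_zero hdet).symm.trans_le ((rank_submatrix_le M f g).trans hM)
  simp at h

/-- Every rectangular matrix over a field is equivalent to a block matrix with an identity block
and zeros elsewhere. -/
lemma exists_rectangular_rank_normal_form {K m n : Type*} [Field K] [Fintype m] [DecidableEq m]
    [Fintype n] [DecidableEq n] (M : Matrix m n K) {r s t : ℕ} (hr : M.rank = r)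
    (hs : r + s = Fintype.card m) (ht : r + t = Fintype.card n) :
    ∃ (P : Matrix m (Fin r ⊕ Fin s) K) (P' : Matrix (Fin r ⊕ Fin s) m K)
      (Q : Matrix (Fin r ⊕ Fin t) n K) (Q' : Matrix n (Fin r ⊕ Fin t) K),
      P * P' = 1 ∧ P' * P = 1 ∧ Q * Q' = 1 ∧ Q' * Q = 1 ∧ P' * M * Q' = fromBlocks 1 0 0 0 := by
  let f := toLin' M
  obtain ⟨C, hC⟩ := (LinearMap.ker f).exists_isCompl
  obtain ⟨D, hD⟩ := (LinearMap.range f).exists_isCompl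
  have hrange : Module.finrank K (LinearMap.range f) = r := hr
  have hCr : Module.finrank K C = r :=
    (LinearMap.kerComplementEquivRange f hC.symm).finrank_eq.trans hrange
  have hker : Module.finrank K (LinearMap.ker f) = t := by
    have := f.finrank_range_add_finrank_ker
    rw [Module.finrank_fintype_fun_eq_card] at this
    omega
  have hDs : Module.finrank K D = s := by
    have := Submodule.finrank_add_eq_of_isCompl hD
    rw [Module.finrank_fintype_fun_eq_card] at this
    omega
  let bC : Module.Basis (Fin r) K C := Module.finBasisOfFinrankEq K C hCr
  let bR := bC.map (LinearMap.kerComplementEquivRange f hC.symm)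
  let bV := (bC.prod (Module.finBasisOfFinrankEq K _ hker)).map
    (Submodule.prodEquivOfIsCompl _ _ hC.symm)
  let bW := (bR.prod (Module.finBasisOfFinrankEq K _ hDs)).map
    (Submodule.prodEquivOfIsCompl _ _ hD)
  let sV := Pi.basisFun K n
  let sW := Pi.basisFun K m
  refine ⟨sW.toMatrix bW, bW.toMatrix sW, bV.toMatrix sV, sV.toMatrix bV,
    sW.toMatrix_mul_toMatrix_flip bW, bW.toMatrix_mul_toMatrix_flip sW,
    bV.toMatrix_mul_toMatrix_flip sV, sV.toMatrix_mul_toMatrix_flip bV, ?_⟩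
  have hMf : M = LinearMap.toMatrix sV sW f := by
    simp only [f, sV, sW]
    exact (LinearMap.toMatrix'_toLin' M).symm
  have h := basis_toMatrix_mul_linearMap_toMatrix_mul_basis_toMatrix bV sV bW sW f
  rw [← hMf] at h
  rw [h]
  have hleft (i : Fin r) : f (bV (Sum.inl i)) = bW (Sum.inl i) := by
    simp [bV, bW, bR]
  have hright (i : Fin t) : f (bV (Sum.inr i)) = 0 := by
    simp [bV]
  ext i (j | j)
  · rw [LinearMap.toMatrix_apply, hleft, Module.Basis.repr_self]
    rcases i with i | i <;> simp [one_apply, Finsupp.single_apply, eq_comm]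
  · rw [LinearMap.toMatrix_apply, hright]
    rcases i with i | i <;> simp

/-- All matrices of the family `A` lie in the span of the rank-one matrices `x_i y_iᵀ`, `i : ι`,
where the `x_i` are the columns of one fixed matrix and the `y_i` the rows of another one. -/
def HasRankOneFactorization {K m n κ : Type*} [Field K] (ι : Type*) [Fintype ι] [DecidableEq ι]
    (A : κ → Matrix m n K) : Prop :=
  ∃ (X : Matrix m ι K) (Y : Matrix ι n K), ∀ k, ∃ d : ι → K, A k = X * diagonal d * Y

namespace HasRankOneFactorization

variable {K m n κ ι ι' : Type*} [Field K] [Fintype ι] [DecidableEq ι] [Fintype ι'] [DecidableEq ι']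

lemma add {A B : κ → Matrix m n K} (hA : HasRankOneFactorization ι A)
    (hB : HasRankOneFactorization ι' B) : HasRankOneFactorization (ι ⊕ ι') (A + B) := by
  obtain ⟨X, Y, h⟩ := hA
  obtain ⟨X', Y', h'⟩ := hB
  refine ⟨fromCols X X', fromRows Y Y', fun k => ?_⟩
  obtain ⟨d, hd⟩ := h k
  obtain ⟨d', hd'⟩ := h' k
  refine ⟨Sum.elim d d', ?_⟩
  rw [← fromBlocks_diagonal, fromCols_mul_fromBlocks, fromCols_mul_fromRows]
  simp [hd, hd']

lemma of_mem_span {κ' : Type*} {A : κ → Matrix m n K} (hA : HasRankOneFactorization ι A)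
    {B : κ' → Matrix m n K} (hB : ∀ k, B k ∈ Submodule.span K (Set.range A)) :
    HasRankOneFactorization ι B := by
  obtain ⟨X, Y, h⟩ := hA
  refine ⟨X, Y, fun k => ?_⟩
  have hk := hB k
  generalize B k = N at hk
  induction hk using Submodule.span_induction with
  | mem M hM => obtain ⟨l, rfl⟩ := hM; exact h l
  | zero => exact ⟨0, by simp⟩
  | add M M' _ _ hM hM' =>
    obtain ⟨d, rfl⟩ := hM
    obtain ⟨d', rfl⟩ := hM'
    refine ⟨d + d', ?_⟩
    rw [← Matrix.add_mul, ← Matrix.mul_add, diagonal_add]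
    rfl
  | smul c M _ hM =>
    obtain ⟨d, rfl⟩ := hM
    exact ⟨c • d, by rw [diagonal_smul, Matrix.mul_smul, Matrix.smul_mul]⟩

lemma mul_mul {m' n' : Type*} [Fintype m] [Fintype n] {A : κ → Matrix m n K}
    (hA : HasRankOneFactorization ι A) (P : Matrix m' m K) (Q : Matrix n n' K) :
    HasRankOneFactorization ι fun k => P * A k * Q := by
  obtain ⟨X, Y, h⟩ := hA
  refine ⟨P * X, Y * Q, fun k => ?_⟩
  obtain ⟨d, hd⟩ := h k
  exact ⟨d, by simp only [hd, Matrix.mul_assoc]⟩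

lemma tensorRank_le [Fintype m] [Fintype n] [Fintype κ] {A : κ → Matrix m n K}
    (hA : HasRankOneFactorization ι A) : tensorRank K A ≤ Fintype.card ι := by
  obtain ⟨X, Y, h⟩ := hA
  choose d hd using h
  let e := (Fintype.equivFin ι).symm
  refine Nat.sInf_le ⟨fun i => X.col (e i), fun i => Y.row (e i), fun i k => d k (e i), fun k => ?_⟩
  rw [e.sum_comp fun i => d k i • vecMulVec (X.col i) (Y.row i), hd]
  ext i j
  rw [mul_apply]
  simp only [mul_diagonal, Matrix.sum_apply, Matrix.smul_apply, vecMulVec_apply, col_apply,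
    row_apply, smul_eq_mul]
  exact Finset.sum_congr rfl fun _ _ => by ring

end HasRankOneFactorization

/-- Three slices, the last of which is in rank normal form, and the last two of which span a pencil
whose rank does not exceed that of the last one near that slice. -/
lemma hasRankOneFactorization_of_rank_add_smul_le {K α β γ : Type*} [Field K] [IsAlgClosed K]
    [CharZero K] [Fintype α] [DecidableEq α] [Fintype β] [DecidableEq β] [Fintype γ]
    [DecidableEq γ] (A₁ A₂ : Matrix (α ⊕ β) (α ⊕ γ) K)
    (hrank : ∀ t : K, (fromBlocks 1 0 0 0 + t • A₂).rank ≤ Fintype.card α) (j : γ)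
    (hj : A₂.toBlocks₁₂.col j = 0 → A₁.toBlocks₁₂.col j = 0) :
    HasRankOneFactorization (α ⊕ α ⊕ β ⊕ {c // c ≠ j}) ![A₁, A₂, fromBlocks 1 0 0 0] := by
  obtain ⟨P₁, Q₁, R₁, S₁, rfl⟩ : ∃ P Q R S, A₁ = fromBlocks P Q R S :=
    ⟨_, _, _, _, A₁.fromBlocks_toBlocks.symm⟩
  obtain ⟨P₂, Q₂, R₂, S₂, rfl⟩ : ∃ P Q R S, A₂ = fromBlocks P Q R S :=
    ⟨_, _, _, _, A₂.fromBlocks_toBlocks.symm⟩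
  simp only [toBlocks_fromBlocks₁₂] at hj
  obtain ⟨N, hN, hNj⟩ := exists_separable_charpoly_mulVec_eq _ _ hj
  obtain ⟨ε, hε, hT, hL⟩ := exists_separable_charpoly_add_smul N (N * P₂ - P₁) P₂ hN
  set T := 1 + ε • P₂ with T_def
  set L := N + ε • (N * P₂ - P₁) with L_def
  have hNT : N * T = L + ε • P₁ := by
    rw [T_def, L_def, Matrix.mul_add, Matrix.mul_one, Matrix.mul_smul, smul_sub]
    abel
  obtain ⟨H, d, hH, hHd⟩ := exists_diagonalization_of_separable_charpoly N hN
  obtain ⟨G, g, hG, hGg⟩ := exists_diagonalization_of_separable_charpoly L hL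
  have hS : ε • S₂ = (ε • R₂) * T⁻¹ * (ε • Q₂) := by
    have h := hrank ε
    rw [fromBlocks_smul, fromBlocks_add, zero_add, zero_add, zero_add] at h
    simpa using toBlocks₂₂_eq_of_rank_le _ (by simpa using hT) h
  let X : Matrix (α ⊕ β) α K := fromRows 1 ((ε • R₂) * T⁻¹)
  let Y : Matrix α (α ⊕ γ) K := fromCols 1 (T⁻¹ * (ε • Q₂))
  have hXTY : X * T * Y = fromBlocks 1 0 0 0 + ε • fromBlocks P₂ Q₂ R₂ S₂ := by
    rw [fromRows_mul, fromRows_mul_fromCols, nonsing_inv_mul_cancel_right _ _ hT, fromBlocks_smul,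
      fromBlocks_add, hS]
    simp only [Matrix.one_mul, Matrix.mul_one, zero_add, mul_nonsing_inv_cancel_left _ _ hT,
      Matrix.mul_assoc]
    rw [T_def]
  let Q : Matrix α γ K := ε • Q₁ - N * (ε • Q₂)
  let R : Matrix β α K := ε • R₁ - (ε • R₂) * T⁻¹ * N * T
  let S : Matrix β γ K := ε • S₁ - (ε • R₂) * T⁻¹ * N * (ε • Q₂)
  have hQ (i : α) : Q i j = 0 := by
    have h := congrFun hNj i
    simp only [mulVec, dotProduct, col_apply] at h
    simp [Q, Matrix.mul_apply, h]
  have hXNTY : X * (N * T) * Y = fromBlocks (N * T) (N * (ε • Q₂))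
      ((ε • R₂) * T⁻¹ * N * T) ((ε • R₂) * T⁻¹ * N * (ε • Q₂)) := by
    rw [fromRows_mul, fromRows_mul_fromCols]
    simp only [Matrix.one_mul, Matrix.mul_one, Matrix.mul_assoc,
      mul_nonsing_inv_cancel_left _ _ hT]
  have h₁ : HasRankOneFactorization α
      ![fromBlocks (-L) 0 0 0, 0, (fromBlocks 1 0 0 0 : Matrix (α ⊕ β) (α ⊕ γ) K)] := by
    have hD (e : α → K) : fromRows G 0 * diagonal e * fromCols G⁻¹ 0 =
        (fromBlocks (G * diagonal e * G⁻¹) 0 0 0 : Matrix (α ⊕ β) (α ⊕ γ) K) := by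
      rw [fromRows_mul, fromRows_mul_fromCols]
      simp
    refine ⟨fromRows G 0, fromCols G⁻¹ 0, fun k => ?_⟩
    fin_cases k
    · refine ⟨-g, ?_⟩
      rw [hD, show diagonal (-g) = -diagonal g from (diagonal_neg g).symm,
        Matrix.mul_neg, Matrix.neg_mul, ← hGg, mul_nonsing_inv_cancel_right _ _ hG]
      rfl
    · exact ⟨0, by simp⟩
    · refine ⟨1, ?_⟩
      rw [hD, show diagonal (1 : α → K) = 1 from diagonal_one, Matrix.mul_one,
        mul_nonsing_inv _ hG]
      rfl
  have h₂ : HasRankOneFactorization α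
      ![X * (N * T) * Y, X * T * Y, (0 : Matrix (α ⊕ β) (α ⊕ γ) K)] := by
    refine ⟨X * H, H⁻¹ * T * Y, fun k => ?_⟩
    fin_cases k
    · refine ⟨d, ?_⟩
      rw [Matrix.mul_assoc X H, ← hHd]
      simp [Matrix.mul_assoc, mul_nonsing_inv_cancel_left _ _ hH]
    · refine ⟨1, ?_⟩
      rw [show diagonal (1 : α → K) = 1 from diagonal_one]
      simp [Matrix.mul_assoc, mul_nonsing_inv_cancel_left _ _ hH]
    · exact ⟨0, by simp⟩
  have h₃ : HasRankOneFactorization β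
      ![fromBlocks 0 0 R S, 0, (0 : Matrix (α ⊕ β) (α ⊕ γ) K)] := by
    refine ⟨fromRows 0 1, fromCols R S, fun k => ?_⟩
    fin_cases k
    · refine ⟨1, ?_⟩
      rw [show diagonal (1 : β → K) = 1 from diagonal_one, Matrix.mul_one, fromRows_mul_fromCols]
      simp
    · exact ⟨0, by simp⟩
    · exact ⟨0, by simp⟩
  have h₄ : HasRankOneFactorization {c // c ≠ j}
      ![fromBlocks 0 Q 0 0, 0, (0 : Matrix (α ⊕ β) (α ⊕ γ) K)] := by
    let E : Matrix {c // c ≠ j} γ K := of fun l c => if l = c then 1 else 0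
    let F : Matrix α {c // c ≠ j} K := Q.submatrix id Subtype.val
    have hFE : F * E = Q := by
      ext i c
      by_cases hc : c = j
      · subst hc
        rw [hQ, Matrix.mul_apply]
        exact Finset.sum_eq_zero fun l _ => by simp [E, l.2]
      · rw [Matrix.mul_apply, Finset.sum_eq_single ⟨c, hc⟩]
        · simp [E, F]
        · intro l _ hl
          have hlc : l.val ≠ c := fun h => hl (Subtype.ext h)
          simp [E, hlc]
        · simp
    refine ⟨fromRows F 0, fromCols 0 E, fun k => ?_⟩
    fin_cases k
    · refine ⟨1, ?_⟩
      rw [show diagonal (1 : {c // c ≠ j} → K) = 1 from diagonal_one, Matrix.mul_one,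
        fromRows_mul_fromCols, hFE]
      simp
    · exact ⟨0, by simp⟩
    · exact ⟨0, by simp⟩
  have hsum : ![ε • fromBlocks P₁ Q₁ R₁ S₁, fromBlocks 1 0 0 0 + ε • fromBlocks P₂ Q₂ R₂ S₂,
      fromBlocks 1 0 0 0] = ![fromBlocks (-L) 0 0 0, 0, fromBlocks 1 0 0 0] +
      (![X * (N * T) * Y, X * T * Y, 0] + (![fromBlocks 0 0 R S, 0, 0] +
        ![fromBlocks 0 Q 0 0, 0, 0])) := by
    ext k : 1
    fin_cases k
    · change ε • fromBlocks P₁ Q₁ R₁ S₁ = fromBlocks (-L) 0 0 0 +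
        (X * (N * T) * Y + (fromBlocks 0 0 R S + fromBlocks 0 Q 0 0))
      rw [hXNTY, hNT]
      simp [fromBlocks_add, fromBlocks_smul, Q, R, S]
    · simp [hXTY]
    · simp
  have h := h₁.add (h₂.add (h₃.add h₄))
  rw [← hsum] at h
  refine h.of_mem_span fun k => ?_
  have hmem (k) := Submodule.subset_span (R := K) (Set.mem_range_self (f := ![
    ε • fromBlocks P₁ Q₁ R₁ S₁, fromBlocks 1 0 0 0 + ε • fromBlocks P₂ Q₂ R₂ S₂,
    fromBlocks 1 0 0 0]) k)
  fin_cases k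
  · simpa [smul_smul, hε] using Submodule.smul_mem _ ε⁻¹ (hmem 0)
  · simpa [smul_smul, hε] using Submodule.smul_mem _ ε⁻¹ (Submodule.sub_mem _ (hmem 1) (hmem 2))
  · exact hmem 2

/-- An `n × (n + 1) × 3` tensor over an algebraically closed field of characteristic zero has rank
at most `2 * n`. -/
lemma tensorRank_le_two_mul {K : Type*} [Field K] [IsAlgClosed K] [CharZero K] {n : ℕ}
    (A : Fin 3 → Matrix (Fin n) (Fin (n + 1)) K) : tensorRank K A ≤ 2 * n := by
  let B (c : K × K) : Matrix (Fin n) (Fin (n + 1)) K := A 2 + c.1 • A 0 + c.2 • A 1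
  obtain ⟨c, hc⟩ : ∃ c, ∀ c', (B c').rank ≤ (B c).rank := by
    have hfin : (Set.range fun c => (B c).rank).Finite :=
      (Set.finite_Iic n).subset (by rintro _ ⟨c, rfl⟩; exact rank_le_height _)
    obtain ⟨_, ⟨c, rfl⟩, hc⟩ := hfin.exists_maximal (Set.range_nonempty _)
    exact ⟨c, fun c' => (le_total _ _).elim id (hc ⟨c', rfl⟩)⟩
  have hle : (B c).rank ≤ n := rank_le_height _
  obtain ⟨P, P', Q, Q', hPP', hP'P, hQQ', hQ'Q, hnf⟩ :=
    exists_rectangular_rank_normal_form (B c) (s := n - (B c).rank) (t := n + 1 - (B c).rank) rfl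
      (by rw [Fintype.card_fin]; omega) (by rw [Fintype.card_fin]; omega)
  have hback (M : Matrix (Fin n) (Fin (n + 1)) K) : P * (P' * M * Q') * Q = M := by
    calc P * (P' * M * Q') * Q = (P * P') * M * (Q' * Q) := by simp only [Matrix.mul_assoc]
      _ = M := by rw [hPP', hQ'Q, Matrix.one_mul, Matrix.mul_one]
  have hrank (M) (t : K) (hM : ∃ c', B c + t • M = B c') :
      (fromBlocks 1 0 0 0 + t • (P' * M * Q')).rank ≤ Fintype.card (Fin (B c).rank) := by
    obtain ⟨c', hc'⟩ := hM
    rw [← hnf, ← Matrix.smul_mul, ← Matrix.mul_smul, ← Matrix.add_mul, ← Matrix.mul_add, hc',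
      Fintype.card_fin]
    exact (rank_mul_le_left _ _).trans ((rank_mul_le_right _ _).trans (hc c'))
  let j : Fin (n + 1 - (B c).rank) := ⟨0, by omega⟩
  have hcard : Fintype.card (Fin (B c).rank ⊕ Fin (B c).rank ⊕ Fin (n - (B c).rank) ⊕
      {l // l ≠ j}) = 2 * n := by
    simp only [Fintype.card_sum, Fintype.card_fin, Fintype.card_subtype_compl,
      Fintype.card_unique]
    omega
  obtain ⟨k, l, hkl, h⟩ : ∃ k l, (k = 0 ∧ l = 1 ∨ k = 1 ∧ l = 0) ∧ HasRankOneFactorization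
      (Fin (B c).rank ⊕ Fin (B c).rank ⊕ Fin (n - (B c).rank) ⊕ {l // l ≠ j})
      ![P' * A k * Q', P' * A l * Q', fromBlocks 1 0 0 0] := by
    by_cases h : (P' * A 1 * Q').toBlocks₁₂.col j = 0 → (P' * A 0 * Q').toBlocks₁₂.col j = 0
    · refine ⟨0, 1, by simp, hasRankOneFactorization_of_rank_add_smul_le _ _
        (fun t => hrank _ t ⟨c + (0, t), ?_⟩) j h⟩
      simp [B, add_smul, add_assoc]
    · push Not at h
      refine ⟨1, 0, by simp, hasRankOneFactorization_of_rank_add_smul_le _ _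
        (fun t => hrank _ t ⟨c + (t, 0), ?_⟩) j fun _ => h.1⟩
      simp only [B, Prod.fst_add, Prod.snd_add, add_smul, zero_smul]
      abel
  rw [← hcard]
  refine ((h.mul_mul P Q).of_mem_span (B := A) fun i => ?_).tensorRank_le
  have hmem (i) := Submodule.subset_span (R := K) (Set.mem_range_self (f := fun i =>
    P * (![P' * A k * Q', P' * A l * Q', fromBlocks 1 0 0 0] : Fin 3 → _) i * Q) i)
  have hk := hmem 0
  have hl := hmem 1
  have hB := hmem 2
  simp only [cons_val, ← hnf, hback] at hk hl hB
  simp only [← hnf]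
  set V := Submodule.span K
    (Set.range fun i => P * (![P' * A k * Q', P' * A l * Q', P' * B c * Q'] : Fin 3 → _) i * Q)
  have h01 : A 0 ∈ V ∧ A 1 ∈ V := by
    rcases hkl with ⟨rfl, rfl⟩ | ⟨rfl, rfl⟩
    · exact ⟨hk, hl⟩
    · exact ⟨hl, hk⟩
  fin_cases i
  · exact h01.1
  · exact h01.2
  · have := Submodule.sub_mem _ (Submodule.sub_mem _ hB (Submodule.smul_mem _ c.1 h01.1))
      (Submodule.smul_mem _ c.2 h01.2)
    convert this using 1
    simp only [B]
    abel

/-- For every positive integer `n`, every `n × (n+1) × 3` tensor over `ℂ` has rank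
at most `2 * n`. -/
theorem stmt11 {n : ℕ} (hn : 0 < n) :
    maxRank ℂ n (n + 1) 3 ≤ 2 * n := by
  refine csSup_le' ?_
  rintro _ ⟨A, rfl⟩
  exact tensorRank_le_two_mul A
end

section
/- Let 𝔽 be ℝ or ℂ and let m ≥ 2 be an integer. Let a_1, …, a_s and b_1, …, b_t be nonzero vectors in 𝔽^m, and let A_1, …, A_u and B_1, …, B_v be m×2 matrices over 𝔽 of rank 2. Then there exists an invertible m×m matrix P over 𝔽 such that: every entry of P·a_i is nonzero for i = 1,…,s; every entry of b_iᵀ·P⁻¹ is nonzero for i = 1,…,t; every 2×2 minor of P·A_i (the determinant of the 2×2 submatrix formed by any two rows) is nonzero for i = 1,…,u; and every 2×2 minor of B_iᵀ·P⁻¹ (the determinant of the 2×2 submatrix formed by any two columns) is nonzero for i = 1,…,v. -/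
open Matrix

/-- A property of square matrices is generic if it holds wherever some fixed nonzero polynomial
in the entries does not vanish. -/
def IsGenericMatrixProperty {K n : Type*} [Field K] (p : Matrix n n K → Prop) : Prop :=
  ∃ f : MvPolynomial (n × n) K, f ≠ 0 ∧
    ∀ P : Matrix n n K, MvPolynomial.eval (fun x => P x.1 x.2) f ≠ 0 → p P

theorem Matrix.mvPolynomialX_map_eval {n R : Type*} [CommSemiring R] (P : Matrix n n R) :
    (mvPolynomialX n n R).map (MvPolynomial.eval fun x => P x.1 x.2) = P := by
  ext i j
  simp

namespace IsGenericMatrixProperty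

variable {K n : Type*} [Field K] {p q : Matrix n n K → Prop}

theorem of_eval (f : MvPolynomial (n × n) K) (P₀ : Matrix n n K)
    (h₀ : MvPolynomial.eval (fun x => P₀ x.1 x.2) f ≠ 0)
    (h : ∀ P : Matrix n n K, MvPolynomial.eval (fun x => P x.1 x.2) f ≠ 0 → p P) :
    IsGenericMatrixProperty p :=
  ⟨f, fun hf => h₀ (by simp [hf]), h⟩

theorem exists_matrix [Infinite K] (hp : IsGenericMatrixProperty p) : ∃ P, p P := by
  obtain ⟨f, hf, h⟩ := hp
  by_contra! hP
  refine hf (MvPolynomial.funext fun x => ?_)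
  by_contra hx
  exact hP (Matrix.of fun i j => x (i, j)) (h _ (by simpa using hx))

theorem and (hp : IsGenericMatrixProperty p) (hq : IsGenericMatrixProperty q) :
    IsGenericMatrixProperty fun P => p P ∧ q P := by
  obtain ⟨f, hf, hf'⟩ := hp
  obtain ⟨g, hg, hg'⟩ := hq
  refine ⟨f * g, mul_ne_zero hf hg, fun P hP => ?_⟩
  rw [map_mul] at hP
  exact ⟨hf' P (left_ne_zero_of_mul hP), hg' P (right_ne_zero_of_mul hP)⟩

theorem forall_finite {ι : Sort*} [Finite ι] {r : ι → Matrix n n K → Prop}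
    (hr : ∀ i, IsGenericMatrixProperty (r i)) :
    IsGenericMatrixProperty fun P => ∀ i, r i P := by
  choose f hf h using hr
  have := Fintype.ofFinite (PLift ι)
  refine ⟨∏ i : PLift ι, f i.down, Finset.prod_ne_zero_iff.2 fun i _ => hf _, fun P hP i => ?_⟩
  rw [map_prod, Finset.prod_ne_zero_iff] at hP
  exact h i P (hP ⟨i⟩ (Finset.mem_univ _))

variable [Fintype n]

theorem det_ne_zero [DecidableEq n] :
    IsGenericMatrixProperty fun P : Matrix n n K => P.det ≠ 0 := by
  have key (P : Matrix n n K) :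
      MvPolynomial.eval (fun x => P x.1 x.2) (mvPolynomialX n n K).det = P.det := by
    rw [RingHom.map_det, RingHom.mapMatrix_apply, mvPolynomialX_map_eval]
  refine of_eval (mvPolynomialX n n K).det 1 ?_ fun P hP => ?_
  · simp [key]
  · rwa [key] at hP

variable {κ : Type*} [Fintype κ] [DecidableEq κ]

theorem minor_mul_ne_zero {A : Matrix n κ K} (hA : ∃ L : Matrix κ n K, L * A = 1)
    {e : κ → n} (he : e.Injective) :
    IsGenericMatrixProperty fun P => ((P * A).submatrix e id).det ≠ 0 := by
  obtain ⟨L, hL⟩ := hA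
  have key (P : Matrix n n K) : MvPolynomial.eval (fun x => P x.1 x.2)
      ((mvPolynomialX n n K * A.map (MvPolynomial.C (σ := n × n))).submatrix e id).det =
        ((P * A).submatrix e id).det := by
    rw [RingHom.map_det, RingHom.mapMatrix_apply, ← submatrix_map, Matrix.map_mul,
      mvPolynomialX_map_eval]
    congr 3
    ext i j
    simp
  refine of_eval _ (Matrix.of (Function.extend e L 0)) ?_ fun P hP => by rwa [key] at hP
  have hLe : (Matrix.of (Function.extend e L 0) * A).submatrix e id = L * A := by
    ext i j
    exact congrArg (fun l => l ⬝ᵥ fun k => A k j) (he.extend_apply L 0 i)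
  rw [key, hLe, hL, det_one]
  exact one_ne_zero

theorem minor_mul_inv_ne_zero [DecidableEq n] [Infinite K] {B : Matrix n κ K}
    (hB : ∃ L : Matrix κ n K, L * B = 1) {e : κ → n} (he : e.Injective) :
    IsGenericMatrixProperty fun P => ((Bᵀ * P⁻¹).submatrix id e).det ≠ 0 := by
  have key (P : Matrix n n K) : MvPolynomial.eval (fun x => P x.1 x.2)
      (((B.map (MvPolynomial.C (σ := n × n)))ᵀ * (mvPolynomialX n n K).adjugate).submatrix
        id e).det = ((Bᵀ * P.adjugate).submatrix id e).det := by
    rw [RingHom.map_det, RingHom.mapMatrix_apply]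
    have hadj : (mvPolynomialX n n K).adjugate.map (MvPolynomial.eval fun x => P x.1 x.2) =
        P.adjugate := by
      rw [← RingHom.mapMatrix_apply, RingHom.map_adjugate, RingHom.mapMatrix_apply,
        mvPolynomialX_map_eval]
    rw [← submatrix_map, Matrix.map_mul, hadj]
    congr 3
    ext i j
    simp
  have scale (P : Matrix n n K) (hP : P.det ≠ 0) :
      ((Bᵀ * P.adjugate).submatrix id e).det ≠ 0 ↔ ((Bᵀ * P⁻¹).submatrix id e).det ≠ 0 := by
    rw [inv_def, Ring.inverse_eq_inv', Matrix.mul_smul,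
      show (P.det⁻¹ • (Bᵀ * P.adjugate)).submatrix id e =
        P.det⁻¹ • (Bᵀ * P.adjugate).submatrix id e from rfl,
      det_smul]
    simp [hP]
  obtain ⟨R, hR, hRB⟩ := (det_ne_zero.and (minor_mul_ne_zero hB he)).exists_matrix
  have hdet : (Rᵀ⁻¹).det ≠ 0 := by
    rw [det_nonsing_inv, det_transpose, Ring.inverse_eq_inv']
    exact inv_ne_zero hR
  have hadj : IsGenericMatrixProperty fun P : Matrix n n K =>
      ((Bᵀ * P.adjugate).submatrix id e).det ≠ 0 := by
    refine of_eval _ Rᵀ⁻¹ ?_ fun P hP => by rwa [key] at hP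
    rw [key, scale _ hdet, nonsing_inv_nonsing_inv _ (by simpa using hR), ← transpose_mul,
      ← transpose_submatrix, det_transpose]
    exact hRB
  obtain ⟨f, hf, h⟩ := det_ne_zero.and hadj
  exact ⟨f, hf, fun P hP => (scale P (h P hP).1).1 (h P hP).2⟩

end IsGenericMatrixProperty

theorem Matrix.exists_mul_eq_one_of_rank_eq_card {K n κ : Type*} [Field K] [Fintype n]
    [DecidableEq n] [Fintype κ] [DecidableEq κ] {A : Matrix n κ K}
    (hA : A.rank = Fintype.card κ) : ∃ L : Matrix κ n K, L * A = 1 := by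
  have hinj : Function.Injective A.mulVec := by
    rw [mulVec_injective_iff, linearIndependent_iff_card_eq_finrank_span, Set.finrank,
      ← rank_eq_finrank_span_cols, hA]
  obtain ⟨g, hg⟩ := (toLin' A).exists_leftInverse_of_injective (LinearMap.ker_eq_bot.2 hinj)
  refine ⟨LinearMap.toMatrix' g, ?_⟩
  rw [← LinearMap.toMatrix'_toLin' A, ← LinearMap.toMatrix'_comp, hg, LinearMap.toMatrix'_id]

theorem Matrix.exists_mul_replicateCol_eq_one {K n : Type*} [Field K] [Fintype n]
    [DecidableEq n] {a : n → K} (ha : a ≠ 0) :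
    ∃ L : Matrix Unit n K, L * replicateCol Unit a = 1 := by
  obtain ⟨k, hk⟩ := Function.ne_iff.1 ha
  refine ⟨replicateRow Unit (Pi.single k (a k)⁻¹), ?_⟩
  ext i j
  simpa [mul_apply, Pi.single_apply] using inv_mul_cancel₀ hk

/-- Let `𝔽` be `ℝ` or `ℂ` and `m ≥ 2`.  Given nonzero vectors `a 1, …, a s` and
`b 1, …, b t` in `𝔽^m`, and `m × 2` matrices `A 1, …, A u` and `B 1, …, B v` of
rank `2`, there is an invertible `m × m` matrix `P` such that every entry of each
`P ⬝ a i` and each `(b i)ᵀ ⬝ P⁻¹` is nonzero, and every `2 × 2` minor (on any two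
distinct rows) of each `P * A i` and every `2 × 2` minor (on any two distinct
columns) of each `(B i)ᵀ * P⁻¹` is nonzero. -/
theorem stmt12 {𝔽 : Type*} [RCLike 𝔽] {m s t u v : ℕ} (hm : 2 ≤ m)
    (a : Fin s → Fin m → 𝔽) (ha : ∀ i, a i ≠ 0)
    (b : Fin t → Fin m → 𝔽) (hb : ∀ i, b i ≠ 0)
    (A : Fin u → Matrix (Fin m) (Fin 2) 𝔽) (hA : ∀ i, (A i).rank = 2)
    (B : Fin v → Matrix (Fin m) (Fin 2) 𝔽) (hB : ∀ i, (B i).rank = 2) :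
    ∃ P : Matrix (Fin m) (Fin m) 𝔽, IsUnit P.det ∧
      (∀ i, ∀ j : Fin m, P.mulVec (a i) j ≠ 0) ∧
      (∀ i, ∀ j : Fin m, Matrix.vecMul (b i) P⁻¹ j ≠ 0) ∧
      (∀ i, ∀ j k : Fin m, j ≠ k →
        ((P * A i).submatrix ![j, k] id).det ≠ 0) ∧
      (∀ i, ∀ j k : Fin m, j ≠ k →
        (((B i)ᵀ * P⁻¹).submatrix id ![j, k]).det ≠ 0) := by
  have hinj (j : Fin m) : Function.Injective fun _ : Unit => j := fun _ _ _ => rfl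
  have hpair (x : {x : Fin m × Fin m // x.1 ≠ x.2}) : Function.Injective ![x.1.1, x.1.2] := by
    simpa [Function.Injective, Fin.forall_fin_two] using ⟨x.2, x.2.symm⟩
  have hcol {c : Fin m → 𝔽} (hc : c ≠ 0) := exists_mul_replicateCol_eq_one hc
  have hrank {C : Matrix (Fin m) (Fin 2) 𝔽} (hC : C.rank = 2) :=
    exists_mul_eq_one_of_rank_eq_card (A := C) (by simpa using hC)
  obtain ⟨P, hdet, hPa, hPb, hPA, hPB⟩ := IsGenericMatrixProperty.exists_matrix <|
    .and (.det_ne_zero (K := 𝔽) (n := Fin m)) <|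
    .and (.forall_finite fun i => .forall_finite fun j => .minor_mul_ne_zero (hcol (ha i)) (hinj j))
    <| .and (.forall_finite fun i => .forall_finite fun j =>
      .minor_mul_inv_ne_zero (hcol (hb i)) (hinj j)) <|
    .and (.forall_finite fun i => .forall_finite fun x =>
      .minor_mul_ne_zero (hrank (hA i)) (hpair x))
      (.forall_finite fun i => .forall_finite fun x =>
        .minor_mul_inv_ne_zero (hrank (hB i)) (hpair x))
  refine ⟨P, isUnit_iff_ne_zero.2 hdet, fun i j => ?_, fun i j => ?_,
    fun i j k hjk => hPA i ⟨(j, k), hjk⟩, fun i j k hjk => hPB i ⟨(j, k), hjk⟩⟩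
  · have h := hPa i j
    rwa [det_unique] at h
  · have h := hPb i j
    rwa [det_unique] at h
end

section
/- Let 𝔽 be ℝ or ℂ, let n ≥ 3 be an integer, and let A_1 and A_2 be n×n matrices over 𝔽 whose (n,n) entries are both zero. Suppose the n-th column of A_1 is nonzero, the n-th row of A_1 is nonzero, and for every t ∈ 𝔽, the n-th column of tA_1 + A_2 is nonzero or the n-th row of tA_1 + A_2 is nonzero. Then there exists an invertible (n−1)×(n−1) matrix P over 𝔽 such that the matrices A = Diag(P,1)·A_1·Diag(P,1)⁻¹ and B = Diag(P,1)·A_2·Diag(P,1)⁻¹ satisfy: the (n−1,n) and (n,n−1) entries of A are nonzero, the (n,n) entries of A and B are zero, and B_{n−1,n}/A_{n−1,n} ≠ B_{n,n−1}/A_{n,n−1}. -/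
open Matrix

/-- Over an infinite field, finitely many nonzero vectors admit a vector whose dot product with
each of them is nonzero. -/
lemma exists_forall_dotProduct_ne_zero {K ι m : Type*} [Field K] [Infinite K] [Finite ι]
    [Fintype m] (v : ι → m → K) (hv : ∀ i, v i ≠ 0) :
    ∃ x : m → K, ∀ i, v i ⬝ᵥ x ≠ 0 := by
  classical
  refine Module.Dual.exists_forall_ne_zero_of_forall_exists
    (fun i => dotProductEquiv K m (v i)) fun i => ?_
  by_contra! h
  exact hv i (dotProduct_eq_zero _ h)

/-- General linear matrices act transitively on nonzero vectors. -/
lemma exists_isUnit_mulVec_eq {K m : Type*} [Field K] [Fintype m] [DecidableEq m]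
    {y e : m → K} (hy : y ≠ 0) (he : e ≠ 0) :
    ∃ R : Matrix m m K, IsUnit R ∧ R *ᵥ y = e := by
  obtain ⟨g, hg⟩ := Submodule.exists_linearEquiv_restrict_eq
    ((LinearEquiv.toSpanNonzeroSingleton K _ y hy).symm ≪≫ₗ
      LinearEquiv.toSpanNonzeroSingleton K _ e he)
  refine ⟨LinearMap.toMatrix' g.toLinearMap, ?_, ?_⟩
  · refine IsUnit.of_mul_eq_one (LinearMap.toMatrix' g.symm.toLinearMap) ?_
    rw [← LinearMap.toMatrix'_comp]
    simp
  · have h := hg (LinearEquiv.toSpanNonzeroSingleton K _ y hy 1)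
    rw [LinearEquiv.trans_apply, LinearEquiv.symm_apply_apply] at h
    simpa using h.symm

/-- Vectors `x`, `y` with `x ⬝ᵥ y = 1` are the `i`-th row of an invertible matrix and the `i`-th
column of its inverse. -/
lemma exists_isUnit_row_eq_and_inv_col_eq {K m : Type*} [Field K] [Fintype m] [DecidableEq m]
    (i : m) {x y : m → K} (hxy : x ⬝ᵥ y = 1) :
    ∃ P : Matrix m m K, IsUnit P ∧ P.row i = x ∧ P⁻¹.col i = y := by
  have hy : y ≠ 0 := by
    rintro rfl
    simp at hxy
  obtain ⟨R, hR, hRy⟩ := exists_isUnit_mulVec_eq hy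
    (Pi.single_ne_zero_iff.2 one_ne_zero : (Pi.single i 1 : m → K) ≠ 0)
  have hRdet := (isUnit_iff_isUnit_det R).1 hR
  set e : m → K := Pi.single i 1
  set w : m → K := x ᵥ* R⁻¹ - e with hw
  have hwe : w ⬝ᵥ e = 0 := by
    rw [hw, sub_dotProduct, ← hRy, ← dotProduct_mulVec, mulVec_mulVec, nonsing_inv_mul _ hRdet,
      one_mulVec, hxy, hRy]
    simp [e]
  have hS : IsUnit (1 + vecMulVec e w) := by
    refine IsUnit.of_mul_eq_one (1 - vecMulVec e w) ?_
    simp [add_mul, mul_sub, vecMulVec_mul_vecMulVec, hwe]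
  have hP : IsUnit ((1 + vecMulVec e w) * R) := hS.mul hR
  refine ⟨_, hP, ?_, ?_⟩
  · have : e ᵥ* ((1 + vecMulVec e w) * R) = x := by
      rw [← vecMul_vecMul, vecMul_add, vecMul_one, vecMul_vecMulVec]
      simp [e, w, vecMul_vecMul, nonsing_inv_mul _ hRdet]
    rw [← this, single_one_vecMul]
  · have : ((1 + vecMulVec e w) * R) *ᵥ y = e := by
      rw [← mulVec_mulVec, hRy, add_mulVec, one_mulVec, vecMulVec_mulVec, hwe]
      simp
    rw [← mulVec_single_one]
    calc ((1 + vecMulVec e w) * R)⁻¹ *ᵥ e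
        = ((1 + vecMulVec e w) * R)⁻¹ *ᵥ ((1 + vecMulVec e w) * R) *ᵥ y := by rw [this]
      _ = y := by
        rw [mulVec_mulVec, nonsing_inv_mul _ ((isUnit_iff_isUnit_det _).1 hP), one_mulVec]

/-- If `a`, `b` are nonzero and `(c, d)` is not a multiple of `(a, b)`, some column of
`c bᵀ - a dᵀ` is nonzero. -/
lemma exists_smul_sub_smul_ne_zero {K m : Type*} [Field K] {a b c d : m → K}
    (ha : a ≠ 0) (hb : b ≠ 0) (h : ∀ s : K, c = s • a → d ≠ s • b) :
    ∃ j, b j • c - d j • a ≠ 0 := by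
  by_contra! H
  obtain ⟨k, hk⟩ := Function.ne_iff.1 hb
  have hc : c = (d k / b k) • a := by
    rw [div_eq_inv_mul, mul_smul, ← sub_eq_zero.1 (H k), inv_smul_smul₀ hk]
  refine h _ hc (funext fun j => ?_)
  have hj := H j
  rw [hc, smul_smul, ← sub_smul, smul_eq_zero, or_iff_left ha, sub_eq_zero] at hj
  rw [← hj, Pi.smul_apply, smul_eq_mul, mul_comm]

/-- Separating the pairs `(a, b)` and `(c, d)` by evaluation at a normalized pair `(x, y)`. -/
lemma exists_dotProduct_eq_one_and_div_ne {K m : Type*} [Field K] [Infinite K] [Fintype m]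
    {a b c d : m → K} (ha : a ≠ 0) (hb : b ≠ 0) (h : ∀ s : K, c = s • a → d ≠ s • b) :
    ∃ x y : m → K, x ⬝ᵥ y = 1 ∧ x ⬝ᵥ a ≠ 0 ∧ b ⬝ᵥ y ≠ 0 ∧
      (x ⬝ᵥ c) / (x ⬝ᵥ a) ≠ (d ⬝ᵥ y) / (b ⬝ᵥ y) := by
  obtain ⟨j, hj⟩ := exists_smul_sub_smul_ne_zero ha hb h
  obtain ⟨x, hx⟩ := exists_forall_dotProduct_ne_zero ![a, b j • c - d j • a]
    (by simp [Fin.forall_fin_two, ha, hj])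
  obtain ⟨hxa, hxj⟩ := Fin.forall_fin_two.1 hx
  simp only [cons_val_zero, cons_val_one, dotProduct_comm _ x] at hxa hxj
  have hx0 : x ≠ 0 := by
    rintro rfl
    simp at hxa
  have hxM : (x ⬝ᵥ c) • b - (x ⬝ᵥ a) • d ≠ 0 := by
    refine Function.ne_iff.2 ⟨j, ?_⟩
    simpa [mul_comm] using hxj
  obtain ⟨y, hy⟩ := exists_forall_dotProduct_ne_zero ![x, b, (x ⬝ᵥ c) • b - (x ⬝ᵥ a) • d]
    (by simp [Fin.forall_fin_succ, hx0, hb, hxM])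
  have hxy : x ⬝ᵥ y ≠ 0 := hy 0
  have hby : b ⬝ᵥ y ≠ 0 := hy 1
  have hMy : ((x ⬝ᵥ c) • b - (x ⬝ᵥ a) • d) ⬝ᵥ y ≠ 0 := hy 2
  have hne : (x ⬝ᵥ c) / (x ⬝ᵥ a) ≠ (d ⬝ᵥ y) / (b ⬝ᵥ y) := by
    rw [Ne, div_eq_div_iff hxa hby, ← sub_eq_zero]
    simpa [sub_dotProduct, mul_comm] using hMy
  refine ⟨x, (x ⬝ᵥ y)⁻¹ • y, ?_, hxa, ?_, ?_⟩
  · simp [hxy]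
  · simp [hxy, hby]
  · simpa [mul_div_mul_left, hxy] using hne

/-- Conjugating a block matrix by `Diag(P, 1)`. -/
lemma fromBlocks_one_conj {K m : Type*} [Field K] [Fintype m] [DecidableEq m]
    {P : Matrix m m K} (hP : IsUnit P) (A : Matrix (m ⊕ Unit) (m ⊕ Unit) K) :
    fromBlocks P 0 0 (1 : Matrix Unit Unit K) * A * (fromBlocks P 0 0 (1 : Matrix Unit Unit K))⁻¹ =
      fromBlocks (P * A.toBlocks₁₁ * P⁻¹) (P * A.toBlocks₁₂) (A.toBlocks₂₁ * P⁻¹)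
        A.toBlocks₂₂ := by
  rw [inv_fromBlocks_zero₂₁_of_isUnit_iff _ _ _ (by simp [hP])]
  conv_lhs => rw [← fromBlocks_toBlocks A]
  simp [fromBlocks_multiply]

/-- A vector indexed by `m ⊕ Unit` vanishing at the last index is determined by its restriction
to `m`. -/
lemma comp_inl_ne_zero {K m : Type*} [Zero K] {v : m ⊕ Unit → K} (hv : v ≠ 0)
    (h : v (Sum.inr ()) = 0) : (fun i => v (Sum.inl i)) ≠ 0 := by
  contrapose! hv
  funext i
  rcases i with i | ⟨⟩
  · exact congrFun hv i
  · exact h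

/-- Let `𝔽` be `ℝ` or `ℂ`, `n ≥ 3`, and let `A₁`, `A₂` be `n × n` matrices over `𝔽`
(rows and columns indexed by `Fin (n-1) ⊕ Unit`, so that the `n`-th row/column is
the `Sum.inr` one) whose `(n, n)` entries are zero.  Suppose the `n`-th column and
the `n`-th row of `A₁` are nonzero, and for every `t ∈ 𝔽` the `n`-th column or the
`n`-th row of `t • A₁ + A₂` is nonzero.  Then there is an invertible
`(n-1) × (n-1)` matrix `P` such that, with `Q = Diag(P, 1)`,
`A = Q * A₁ * Q⁻¹` and `B = Q * A₂ * Q⁻¹` satisfy: the `(n-1, n)` and `(n, n-1)`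
entries of `A` are nonzero, the `(n, n)` entries of `A` and `B` are zero, and
`B_{n-1,n} / A_{n-1,n} ≠ B_{n,n-1} / A_{n,n-1}`. -/
theorem stmt14 {𝔽 : Type*} [RCLike 𝔽] {n : ℕ} (hn : 3 ≤ n)
    (A₁ A₂ : Matrix (Fin (n - 1) ⊕ Unit) (Fin (n - 1) ⊕ Unit) 𝔽)
    (h11 : A₁ (Sum.inr ()) (Sum.inr ()) = 0)
    (h21 : A₂ (Sum.inr ()) (Sum.inr ()) = 0)
    (hcol : (fun i => A₁ i (Sum.inr ())) ≠ 0)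
    (hrow : (fun j => A₁ (Sum.inr ()) j) ≠ 0)
    (ht : ∀ t : 𝔽, (fun i => (t • A₁ + A₂) i (Sum.inr ())) ≠ 0 ∨
                   (fun j => (t • A₁ + A₂) (Sum.inr ()) j) ≠ 0) :
    ∃ P : Matrix (Fin (n - 1)) (Fin (n - 1)) 𝔽, IsUnit P.det ∧
      ∀ Q A B, Q = Matrix.fromBlocks P 0 0 (1 : Matrix Unit Unit 𝔽) →
        A = Q * A₁ * Q⁻¹ → B = Q * A₂ * Q⁻¹ →
        (A (Sum.inl ⟨n - 2, by omega⟩) (Sum.inr ()) ≠ 0 ∧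
         A (Sum.inr ()) (Sum.inl ⟨n - 2, by omega⟩) ≠ 0 ∧
         A (Sum.inr ()) (Sum.inr ()) = 0 ∧
         B (Sum.inr ()) (Sum.inr ()) = 0 ∧
         B (Sum.inl ⟨n - 2, by omega⟩) (Sum.inr ()) /
           A (Sum.inl ⟨n - 2, by omega⟩) (Sum.inr ()) ≠
         B (Sum.inr ()) (Sum.inl ⟨n - 2, by omega⟩) /
           A (Sum.inr ()) (Sum.inl ⟨n - 2, by omega⟩)) := by
  have ha := comp_inl_ne_zero hcol h11
  have hb := comp_inl_ne_zero hrow h11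
  obtain ⟨x, y, hxy, hxa, hby, hne⟩ := exists_dotProduct_eq_one_and_div_ne ha hb
    (c := fun i => A₂ (Sum.inl i) (Sum.inr ())) (d := fun j => A₂ (Sum.inr ()) (Sum.inl j)) (by
      intro s hc hd
      rcases ht (-s) with h | h
      · refine comp_inl_ne_zero h (by simp [h11, h21]) (funext fun i => ?_)
        simp [show A₂ (Sum.inl i) (Sum.inr ()) = s * _ from congrFun hc i]
      · refine comp_inl_ne_zero h (by simp [h11, h21]) (funext fun i => ?_)
        simp [show A₂ (Sum.inr ()) (Sum.inl i) = s * _ from congrFun hd i])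
  obtain ⟨P, hP, rfl, rfl⟩ := exists_isUnit_row_eq_and_inv_col_eq (⟨n - 2, by omega⟩ : Fin (n - 1))
    hxy
  refine ⟨P, (isUnit_iff_isUnit_det P).1 hP, ?_⟩
  rintro _ _ _ rfl rfl rfl
  rw [fromBlocks_one_conj hP, fromBlocks_one_conj hP]
  exact ⟨hxa, hby, h11, h21, hne⟩
end

section
/- Let 𝔽 be ℝ or ℂ, let A and B be n×n matrices over 𝔽, and let a = (a_1,…,a_n)ᵀ and b = (b_1,…,b_n)ᵀ be vectors in 𝔽^n with a_i ≠ 0 for all i = 1,…,n. Then there exist n×n diagonal matrices X and Y over 𝔽 and a vector p ∈ 𝔽^n such that A+X is invertible, (A+X)p = a and (B+Y)p = b. Moreover, if b_1/a_1, …, b_n/a_n are pairwise distinct, then X, Y and p can be chosen so that additionally (A+X)⁻¹(B+Y) has n distinct eigenvalues in 𝔽. -/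
open Filter Topology Matrix

/-- A simple zero in the second variable persists under small changes of the first variable. -/
theorem eventually_exists_zero_of_hasStrictFDerivAt {𝔽 : Type*} [RCLike 𝔽] {f : 𝔽 × 𝔽 → 𝔽}
    {f' : 𝔽 × 𝔽 →L[𝔽] 𝔽} {x₀ y₀ : 𝔽} (hf : HasStrictFDerivAt f f' (x₀, y₀))
    (h0 : f (x₀, y₀) = 0) (hf' : f' (0, 1) ≠ 0) {U : Set 𝔽} (hU : U ∈ 𝓝 y₀) :
    ∀ᶠ x in 𝓝 x₀, ∃ y ∈ U, f (x, y) = 0 := by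
  have hH : HasStrictFDerivAt (fun z : 𝔽 × 𝔽 => (z.1, f z))
      ((ContinuousLinearMap.fst 𝔽 𝔽 𝔽).prod f') (x₀, y₀) :=
    hasStrictFDerivAt_fst.prodMk hf
  have hsurj : ((ContinuousLinearMap.fst 𝔽 𝔽 𝔽).prod f').range = ⊤ := by
    rw [LinearMap.range_eq_top]
    rintro ⟨u, v⟩
    refine ⟨(u, (v - f' (u, 0)) / f' (0, 1)), ?_⟩
    have hsplit : (u, (v - f' (u, 0)) / f' (0, 1))
        = (u, (0 : 𝔽)) + ((v - f' (u, 0)) / f' (0, 1)) • ((0 : 𝔽), (1 : 𝔽)) := by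
      simp
    have hval : f' (u, (v - f' (u, 0)) / f' (0, 1)) = v := by
      rw [hsplit, map_add, map_smul, smul_eq_mul, div_mul_cancel₀ _ hf']
      ring
    simp [hval]
  have hmap := hH.map_nhds_eq_of_surj hsurj
  have hmem : (fun z : 𝔽 × 𝔽 => (z.1, f z)) '' (Set.univ ×ˢ U) ∈ 𝓝 (x₀, (0 : 𝔽)) := by
    rw [← h0, ← hmap]
    exact image_mem_map (prod_mem_nhds univ_mem hU)
  have hcont : Tendsto (fun x : 𝔽 => (x, (0 : 𝔽))) (𝓝 x₀) (𝓝 (x₀, 0)) :=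
    (Continuous.prodMk_left (0 : 𝔽)).tendsto x₀
  filter_upwards [hcont hmem] with x hx
  obtain ⟨⟨s, y⟩, ⟨-, hy⟩, hxy⟩ := hx
  obtain ⟨rfl, h⟩ := Prod.mk.inj hxy
  exact ⟨y, hy, h⟩

/-- The roots `b i / a i` of the pencil `y • diagonal a - diagonal b`, when pairwise distinct,
persist under small perturbations of the two diagonal matrices. -/
theorem eventually_exists_det_pencil_eq_zero {𝔽 ι : Type*} [RCLike 𝔽] [Fintype ι] [DecidableEq ι]
    (A B : Matrix ι ι 𝔽) (a b : ι → 𝔽) (ha : ∀ i, a i ≠ 0)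
    (hab : Function.Injective fun i => b i / a i) (i : ι) {U : Set 𝔽} (hU : U ∈ 𝓝 (b i / a i)) :
    ∀ᶠ x in 𝓝 (0 : 𝔽), ∃ y ∈ U,
      (y • (diagonal a + x • A) - (diagonal b + x • B)).det = 0 := by
  have hdiag (y : 𝔽) : (y • (diagonal a + (0 : 𝔽) • A) - (diagonal b + (0 : 𝔽) • B)).det
      = ∏ j, (y * a j - b j) := by
    rw [zero_smul, zero_smul, add_zero, add_zero, ← diagonal_smul, diagonal_sub, det_diagonal]
    simp
  set f : 𝔽 × 𝔽 → 𝔽 := fun z =>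
    (z.2 • (diagonal a + z.1 • A) - (diagonal b + z.1 • B)).det with hfdef
  have hf : ContDiff 𝔽 1 f := by
    simp only [hfdef, det_apply', Matrix.sub_apply, Matrix.smul_apply, Matrix.add_apply,
      smul_eq_mul]
    fun_prop
  have hstrict := hf.contDiffAt.hasStrictFDerivAt (x := (0, b i / a i)) one_ne_zero
  refine eventually_exists_zero_of_hasStrictFDerivAt hstrict ?_ ?_ hU
  · simp only [hfdef, hdiag]
    exact Finset.prod_eq_zero (Finset.mem_univ i) (by rw [div_mul_cancel₀ _ (ha i), sub_self])
  · have h₁ : HasDerivAt (fun y => f (0, y)) (fderiv 𝔽 f (0, b i / a i) (0, 1)) (b i / a i) :=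
      hstrict.hasFDerivAt.comp_hasDerivAt _
        ((hasDerivAt_const _ (0 : 𝔽)).prodMk (hasDerivAt_id _))
    have hg : DifferentiableAt 𝔽 (fun y => ∏ j ∈ Finset.univ.erase i, (y * a j - b j))
        (b i / a i) := by fun_prop
    have h₂ := (((hasDerivAt_id (b i / a i)).mul_const (a i)).sub_const (b i)).mul hg.hasDerivAt
    have hfg : (fun y => f (0, y))
        = (fun y => id y * a i - b i) * fun y => ∏ j ∈ Finset.univ.erase i, (y * a j - b j) := by
      funext y
      simp only [hfdef, hdiag, Pi.mul_apply, id]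
      exact (Finset.mul_prod_erase _ _ (Finset.mem_univ i)).symm
    rw [hfg] at h₁
    rw [h₁.unique h₂]
    simp only [id, one_mul, div_mul_cancel₀ _ (ha i), sub_self, zero_mul, add_zero]
    refine mul_ne_zero (ha i) (Finset.prod_ne_zero_iff.2 fun j hj h => ?_)
    exact (Finset.ne_of_mem_erase hj) (hab (by
      simpa using (div_eq_iff (ha j)).2 (sub_eq_zero.1 h).symm))

theorem eventually_det_diagonal_add_smul_ne_zero {𝔽 ι : Type*} [RCLike 𝔽] [Fintype ι]
    [DecidableEq ι] (A : Matrix ι ι 𝔽) (a : ι → 𝔽) (ha : ∀ i, a i ≠ 0) :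
    ∀ᶠ x in 𝓝 (0 : 𝔽), (diagonal a + x • A).det ≠ 0 := by
  have hc : Continuous fun x : 𝔽 => (diagonal a + x • A).det := by fun_prop
  refine hc.continuousAt.eventually_ne ?_
  simpa [det_diagonal, Finset.prod_ne_zero_iff] using ha

/-- Scaling by `x` turns the diagonal shift of `A` that maps `x • 1` to `a` into a perturbation
of `diagonal a`. -/
theorem smul_add_diagonal_shift {𝔽 ι : Type*} [Field 𝔽] [Fintype ι] [DecidableEq ι]
    (A : Matrix ι ι 𝔽) (a : ι → 𝔽) {x : 𝔽} (hx : x ≠ 0) :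
    x • (A + diagonal (x⁻¹ • a - A *ᵥ 1)) = diagonal a + x • (A - diagonal (A *ᵥ 1)) := by
  have h : diagonal (x⁻¹ • a - A *ᵥ 1) = x⁻¹ • diagonal a - diagonal (A *ᵥ 1) := by
    rw [← diagonal_smul, diagonal_sub]
    rfl
  rw [h, smul_add, smul_sub, smul_sub, smul_inv_smul₀ hx]
  abel

theorem add_diagonal_shift_mulVec {𝔽 ι : Type*} [Field 𝔽] [Fintype ι] [DecidableEq ι]
    (A : Matrix ι ι 𝔽) (a : ι → 𝔽) {x : 𝔽} (hx : x ≠ 0) :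
    (A + diagonal (x⁻¹ • a - A *ᵥ 1)) *ᵥ (x • 1) = a := by
  have h : diagonal (x⁻¹ • a - A *ᵥ 1) *ᵥ 1 = x⁻¹ • a - A *ᵥ 1 := by
    ext i
    simp [mulVec_diagonal]
  rw [mulVec_smul, add_mulVec, h, add_sub_cancel, smul_inv_smul₀ hx]

theorem isUnit_det_of_det_smul_ne_zero {𝔽 ι : Type*} [Field 𝔽] [Fintype ι] [DecidableEq ι]
    {M : Matrix ι ι 𝔽} {x : 𝔽} (h : (x • M).det ≠ 0) : IsUnit M.det := by
  rw [det_smul] at h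
  exact (right_ne_zero_of_mul h).isUnit


/-- A square matrix `M` indexed by a finite type `α` (of cardinality `n`) has
`n` distinct eigenvalues in `𝔽` if there is an injective family of elements of `𝔽`,
indexed by `α`, each of which is an eigenvalue of `M`. -/
def hasDistinctEigenvalues {𝔽 : Type*} [Field 𝔽] {α : Type*} [Fintype α]
    (M : Matrix α α 𝔽) : Prop :=
  ∃ μ : α → 𝔽, Function.Injective μ ∧
    ∀ i, ∃ v : α → 𝔽, v ≠ 0 ∧ M.mulVec v = μ i • v

/-- Let `𝔽` be `ℝ` or `ℂ`, `A`, `B` be `n × n` matrices over `𝔽`, and `a`, `b` be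
vectors in `𝔽^n` with all coordinates of `a` nonzero.  Then there exist diagonal
matrices `X`, `Y` and a vector `p` with `A + X` invertible, `(A + X) p = a` and
`(B + Y) p = b`.  Moreover, if the ratios `b i / a i` are pairwise distinct, then
`X`, `Y`, `p` can be chosen so that in addition `(A + X)⁻¹ * (B + Y)` has `n`
distinct eigenvalues in `𝔽`. -/
theorem stmt15 {𝔽 : Type*} [RCLike 𝔽] {n : ℕ}
    (A B : Matrix (Fin n) (Fin n) 𝔽) (a b : Fin n → 𝔽)
    (ha : ∀ i, a i ≠ 0) :
    (∃ X Y : Matrix (Fin n) (Fin n) 𝔽, ∃ p : Fin n → 𝔽,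
      X.IsDiag ∧ Y.IsDiag ∧ IsUnit (A + X).det ∧
      (A + X).mulVec p = a ∧ (B + Y).mulVec p = b) ∧
    (Function.Injective (fun i => b i / a i) →
      ∃ X Y : Matrix (Fin n) (Fin n) 𝔽, ∃ p : Fin n → 𝔽,
        X.IsDiag ∧ Y.IsDiag ∧ IsUnit (A + X).det ∧
        (A + X).mulVec p = a ∧ (B + Y).mulVec p = b ∧
        hasDistinctEigenvalues ((A + X)⁻¹ * (B + Y))) := by
  have hdet := eventually_det_diagonal_add_smul_ne_zero (A - diagonal (A *ᵥ 1)) a ha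
  constructor
  · obtain ⟨x, hx, hx0⟩ :=
      ((hdet.filter_mono nhdsWithin_le_nhds).and self_mem_nhdsWithin :
        ∀ᶠ x in 𝓝[≠] (0 : 𝔽), _ ∧ x ∈ ({0}ᶜ : Set 𝔽)).exists
    rw [← smul_add_diagonal_shift A a hx0] at hx
    exact ⟨_, _, x • 1, isDiag_diagonal _, isDiag_diagonal _, isUnit_det_of_det_smul_ne_zero hx,
      add_diagonal_shift_mulVec A a hx0, add_diagonal_shift_mulVec B b hx0⟩
  · intro hab
    obtain ⟨U, hU, hUdisj⟩ := Pairwise.exists_mem_filter_of_disjoint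
      (l := fun i => 𝓝 (b i / a i)) fun i j hij => disjoint_nhds_nhds.2 (hab.ne hij)
    have hroots := eventually_all.2 fun i => eventually_exists_det_pencil_eq_zero
      (A - diagonal (A *ᵥ 1)) (B - diagonal (B *ᵥ 1)) a b ha hab i (hU i)
    obtain ⟨x, ⟨hx, hr⟩, hx0⟩ :=
      (((hdet.and hroots).filter_mono nhdsWithin_le_nhds).and self_mem_nhdsWithin :
        ∀ᶠ x in 𝓝[≠] (0 : 𝔽), _ ∧ x ∈ ({0}ᶜ : Set 𝔽)).exists
    rw [← smul_add_diagonal_shift A a hx0] at hx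
    have hunit := isUnit_det_of_det_smul_ne_zero hx
    refine ⟨_, _, x • 1, isDiag_diagonal _, isDiag_diagonal _, hunit,
      add_diagonal_shift_mulVec A a hx0, add_diagonal_shift_mulVec B b hx0, ?_⟩
    rw [← smul_add_diagonal_shift A a hx0, ← smul_add_diagonal_shift B b hx0] at hr
    choose μ hμU hμ using hr
    refine ⟨μ, fun i j hij => ?_, fun i => ?_⟩
    · by_contra hne
      exact Set.disjoint_left.1 (hUdisj hne) (hμU i) (hij ▸ hμU j)
    · obtain ⟨v, hv, hMv⟩ := exists_mulVec_eq_zero_iff.2 (hμ i)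
      refine ⟨v, hv, ?_⟩
      rw [smul_comm, ← smul_sub, smul_mulVec, smul_eq_zero_iff_right hx0, sub_mulVec,
        sub_eq_zero, smul_mulVec] at hMv
      rw [← mulVec_mulVec, ← hMv, mulVec_smul, mulVec_mulVec, nonsing_inv_mul _ hunit, one_mulVec]
end

section
/- Let 𝔽 be ℝ or ℂ and let (A_1; A_2) be an m×n×2 tensor over 𝔽 with m < n. Write A_i = (a_{i,1}, …, a_{i,n}) in columns and let M_i = (A_i)_{≤m} be the m×m matrix of the first m columns of A_i. Suppose M_1 is invertible and M_1⁻¹M_2 has m distinct eigenvalues in 𝔽, and suppose there exist integers m < j_1 < j_2 < … < j_s ≤ n and vectors p_1, …, p_s ∈ 𝔽^m such that M_i · p_t = a_{i,j_t} for i = 1,2 and t = 1,…,s. Then rank_𝔽(A_1; A_2) ≤ n − s. -/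
theorem tensorRank_le_card {𝔽 ι α β γ : Type*} [Field 𝔽] [Fintype ι]
    [Fintype α] [Fintype β] [Fintype γ] (A : γ → Matrix α β 𝔽)
    (a : ι → α → 𝔽) (b : ι → β → 𝔽) (c : ι → γ → 𝔽)
    (h : ∀ k, A k = ∑ i, c i k • Matrix.vecMulVec (a i) (b i)) :
    tensorRank 𝔽 A ≤ Fintype.card ι := by
  refine Nat.sInf_le ⟨a ∘ (Fintype.equivFin ι).symm, b ∘ (Fintype.equivFin ι).symm,
    c ∘ (Fintype.equivFin ι).symm, fun k => ?_⟩
  rw [h k]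
  exact ((Fintype.equivFin ι).symm.sum_comp
    (fun i => c i k • Matrix.vecMulVec (a i) (b i))).symm

theorem hasDistinctEigenvalues.exists_diagonalization {𝔽 α : Type*} [Field 𝔽] [Fintype α]
    [DecidableEq α] {N : Matrix α α 𝔽} (h : hasDistinctEigenvalues N) :
    ∃ (V : Matrix α α 𝔽) (μ : α → 𝔽), IsUnit V ∧ N * V = V * Matrix.diagonal μ := by
  obtain ⟨μ, hμ, hv⟩ := h
  choose v hv0 hv using hv
  have hli : LinearIndependent 𝔽 v :=
    Module.End.eigenvectors_linearIndependent' (Matrix.toLin' N) μ hμ v fun i =>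
      ⟨Module.End.mem_eigenspace_iff.mpr (by simpa using hv i), hv0 i⟩
  refine ⟨(Matrix.of v).transpose, μ, Matrix.linearIndependent_cols_iff_isUnit.mp hli, ?_⟩
  ext x i
  have := congrFun (hv i) x
  rw [Matrix.mul_diagonal]
  simpa [Matrix.mulVec, dotProduct, Matrix.mul_apply, mul_comm] using this

theorem Matrix.mul_diagonal_mul_eq_sum_vecMulVec {R ι α β : Type*} [CommSemiring R] [Fintype ι]
    [DecidableEq ι] (P : Matrix α ι R) (d : ι → R) (Q : Matrix ι β R) :
    P * Matrix.diagonal d * Q = ∑ i, d i • Matrix.vecMulVec (P.col i) (Q.row i) := by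
  ext x y
  rw [Matrix.mul_apply]
  simp only [Matrix.mul_diagonal, Matrix.sum_apply, Matrix.smul_apply,
    Matrix.vecMulVec_apply, Matrix.col_apply, Matrix.row_apply, smul_eq_mul]
  exact Finset.sum_congr rfl fun i _ => by ring

theorem Matrix.eq_sum_vecMulVec_single {R α β : Type*} [Semiring R] [Fintype β]
    [DecidableEq β] (E : Matrix α β R) (S : Finset β) (hE : ∀ y ∉ S, E.col y = 0) :
    E = ∑ y : S, Matrix.vecMulVec (E.col y) (Pi.single (y : β) 1) := by
  ext x y
  rw [Finset.sum_coe_sort S fun y => Matrix.vecMulVec (E.col y) (Pi.single y 1),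
    Matrix.sum_apply]
  by_cases hy : y ∈ S
  · rw [Finset.sum_eq_single_of_mem y hy]
    · simp [Matrix.vecMulVec_apply]
    · intro z _ hz
      simp [Matrix.vecMulVec_apply, hz.symm]
  · rw [Finset.sum_eq_zero]
    · exact congrFun (hE y hy) x
    · intro z hz
      have : y ≠ z := fun h => hy (h ▸ hz)
      simp [Matrix.vecMulVec_apply, this]

/-- A pencil `(M; N)` with `M` invertible and `M⁻¹ * N` diagonalizable contributes one rank-one term
for each of its columns; each column of `A 1 - N * (M⁻¹ * A 0)` in `S` contributes one more. -/
theorem tensorRank_le_card_add {𝔽 α β : Type*} [Field 𝔽] [Fintype α] [DecidableEq α]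
    [Fintype β] [DecidableEq β] (A : Fin 2 → Matrix α β 𝔽) (M N : Matrix α α 𝔽)
    (hM : IsUnit M.det) (hEig : hasDistinctEigenvalues (M⁻¹ * N)) (S : Finset β)
    (hS : ∀ y ∉ S, (A 1 - N * (M⁻¹ * A 0)).col y = 0) :
    tensorRank 𝔽 A ≤ Fintype.card α + S.card := by
  obtain ⟨V, μ, hV, hNV⟩ := hEig.exists_diagonalization
  have hVdet := (Matrix.isUnit_iff_isUnit_det V).mp hV
  have hN : M * V * Matrix.diagonal μ * V⁻¹ = N := by
    rw [mul_assoc M V, ← hNV, mul_assoc, mul_assoc, mul_assoc, Matrix.mul_nonsing_inv V hVdet,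
      mul_one, Matrix.mul_nonsing_inv_cancel_left M N hM]
  have hcard : Fintype.card (α ⊕ S) = Fintype.card α + S.card := by simp
  rw [← hcard]
  set E := A 1 - N * (M⁻¹ * A 0) with hE
  refine tensorRank_le_card A
    (Sum.elim (M * V).col fun y => E.col y)
    (Sum.elim (V⁻¹ * (M⁻¹ * A 0)).row fun y => Pi.single (y : β) 1)
    (Sum.elim (fun i => ![1, μ i]) fun _ => ![0, 1]) fun k => ?_
  rw [Fintype.sum_sum_type]
  simp only [Sum.elim_inl, Sum.elim_inr]
  rw [← Matrix.mul_diagonal_mul_eq_sum_vecMulVec]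
  fin_cases k
  · simp [Matrix.mul_assoc, Matrix.mul_nonsing_inv_cancel_left V _ hVdet,
      Matrix.mul_nonsing_inv_cancel_left M _ hM]
  · simp only [Fin.mk_one, Matrix.cons_val_one, Matrix.cons_val_fin_one, one_smul]
    rw [← Matrix.eq_sum_vecMulVec_single E S hS, ← Matrix.mul_assoc, hN, hE]
    abel

/-- Let `𝔽` be `ℝ` or `ℂ` and `(A 0; A 1)` an `m × n × 2` tensor over `𝔽` with
`m < n`.  Let `M i` be the `m × m` matrix formed by the first `m` columns of `A i`.
Suppose `M 0` is invertible, `(M 0)⁻¹ * (M 1)` has `m` distinct eigenvalues in `𝔽`,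
and there are strictly increasing column indices `j 1 < … < j s` (all beyond the
first `m` columns) and vectors `p 1, …, p s ∈ 𝔽^m` with
`(M i) (p t) = (j t)-th column of A i` for `i = 0, 1` and all `t`.
Then the tensor has rank at most `n - s`. -/
theorem stmt16 {𝔽 : Type*} [RCLike 𝔽] {m n s : ℕ} (hmn : m < n)
    (A : Fin 2 → Matrix (Fin m) (Fin n) 𝔽)
    (M : Fin 2 → Matrix (Fin m) (Fin m) 𝔽)
    (hM : ∀ i, M i = (A i).submatrix id (Fin.castLE hmn.le))
    (hM0 : IsUnit (M 0).det)
    (hEig : hasDistinctEigenvalues ((M 0)⁻¹ * M 1))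
    (j : Fin s → Fin n) (hj : StrictMono j) (hjm : ∀ t, m ≤ (j t : ℕ))
    (p : Fin s → Fin m → 𝔽)
    (hp : ∀ i t, (M i).mulVec (p t) = fun x => A i x (j t)) :
    tensorRank 𝔽 A ≤ n - s := by
  classical
  set T : Finset (Fin n) :=
    Finset.univ.image (Sum.elim (Fin.castLE hmn.le) j) with hT
  have hinj : Function.Injective (Sum.elim (Fin.castLE hmn.le) j) :=
    (Fin.castLE_injective hmn.le).sumElim hj.injective fun x t h => by
      have h1 := congrArg Fin.val h
      have h2 := hjm t
      have h3 := x.isLt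
      simp only [Fin.val_castLE] at h1
      omega
  have hTcard : T.card = m + s := by
    rw [hT, Finset.card_image_of_injective _ hinj]
    simp
  have hT_le : T.card ≤ n := by simpa using T.card_le_univ
  have hcol : ∀ y (q : Fin m → 𝔽), (∀ i, (M i).mulVec q = (A i).col y) →
      (A 1 - M 1 * ((M 0)⁻¹ * A 0)).col y = 0 := by
    intro y q hq
    have h0 : ((M 0)⁻¹ * A 0).col y = q := by
      change (M 0)⁻¹.mulVec ((A 0).col y) = q
      rw [← hq 0, Matrix.mulVec_mulVec, Matrix.nonsing_inv_mul _ hM0, Matrix.one_mulVec]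
    change (A 1).col y - (M 1).mulVec (((M 0)⁻¹ * A 0).col y) = 0
    rw [h0, hq 1, sub_self]
  have key := tensorRank_le_card_add A (M 0) (M 1) hM0 hEig Tᶜ fun y hy => by
    obtain ⟨z, -, rfl⟩ := Finset.mem_image.mp (by simpa only [Finset.mem_compl, not_not] using hy)
    rcases z with x | t
    · refine hcol _ (Pi.single x 1) fun i => ?_
      rw [Matrix.mulVec_single_one, hM i]
      rfl
    · exact hcol _ (p t) fun i => hp i t
  rw [Finset.card_compl, hTcard, Fintype.card_fin, Fintype.card_fin] at key
  omega
end

section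
/- Let 𝔽 be ℝ or ℂ and let m, n be positive integers with m < n. Then max.rank_𝔽(m,n,3) ≤ m + n − 1; that is, every m×n×3 tensor over 𝔽 has rank at most m + n − 1. -/
section TrilinearForms

open Filter Topology Module

/-- Every pair of matrices close to `((I | 0), (diag β | 0))`, with `β` injective, is simultaneously
a combination of as many rank-one matrices as it has columns. -/
theorem eventually_exists_pencil_decomposition {K α κ : Type*} [RCLike K] [Fintype α]
    [Fintype κ] [DecidableEq α] [DecidableEq κ] (β : α → K) (hβ : Function.Injective β) :
    ∀ᶠ M in 𝓝 ((fun i ↦ Sum.elim (fun j ↦ if i = j then 1 else 0) 0,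
        fun i ↦ Sum.elim (fun j ↦ if i = j then β i else 0) 0) :
        (α → α ⊕ κ → K) × (α → α ⊕ κ → K)),
      ∃ (P : α → α ⊕ κ → K) (Q : α ⊕ κ → α ⊕ κ → K) (c d : α ⊕ κ → K),
        (∀ i j, M.1 i j = ∑ l, P i l * Q l j * c l) ∧
        ∀ i j, M.2 i j = ∑ l, P i l * Q l j * d l := by
  let E := ((α → α → K) × (α → α → K) × (α → K)) × (α → κ → K) × (α → κ → K)
  let f : E → (α → α ⊕ κ → K) × (α → α ⊕ κ → K) := fun x ↦
    (fun i j ↦ j.elim (fun j ↦ ∑ l, x.1.1 i l * x.1.2.1 l j)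
      (fun j ↦ ∑ l, x.1.1 i l * x.2.2 l j),
     fun i j ↦ j.elim (fun j ↦ ∑ l, x.1.1 i l * x.1.2.1 l j * x.1.2.2 l)
      (fun j ↦ ∑ l, x.1.1 i l * x.2.2 l j * x.1.2.2 l + x.2.1 i j))
  let a : E := ((fun i j ↦ if i = j then 1 else 0, fun i j ↦ if i = j then 1 else 0, β), 0, 0)
  have hf : ContDiff K 1 f := by
    refine ContDiff.prodMk ?_ ?_ <;>
    · refine contDiff_pi.2 fun i ↦ contDiff_pi.2 fun j ↦ ?_
      rcases j with j | j <;> simp only [Sum.elim_inl, Sum.elim_inr] <;> fun_prop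
  have hs : HasStrictFDerivAt f (fderiv K f a) a := hf.contDiffAt.hasStrictFDerivAt one_ne_zero
  have hline : ∀ (h : E) y, HasDerivAt (fun s : K ↦ f (a + s • h)) y 0 → fderiv K f a h = y := by
    intro h y hy
    have h1 : HasFDerivAt f (fderiv K f a) (a + (0 : K) • h) := by simpa using hs.hasFDerivAt
    have h2 : HasDerivAt (fun s : K ↦ a + s • h) h 0 := by
      have := ((hasDerivAt_id (0 : K)).smul_const h).const_add a
      rwa [one_smul] at this
    exact (h1.comp_hasDerivAt (x := 0) (f := fun s : K ↦ a + s • h) h2).unique hy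
  have hsurj : (fderiv K f a).range = ⊤ := by
    refine LinearMap.range_eq_top.2 fun ⟨X, Y⟩ ↦ ?_
    let p : α → α → K := fun i j ↦
      if i = j then X i (.inl j) else (Y i (.inl j) - β i * X i (.inl j)) / (β j - β i)
    let h : E := ((p, fun i j ↦ X i (.inl j) - p i j,
      fun i ↦ Y i (.inl i) - β i * X i (.inl i)),
      fun i j ↦ Y i (.inr j) - β i * X i (.inr j), fun i j ↦ X i (.inr j))
    have hd : ∀ u v : K, HasDerivAt (fun s : K ↦ u + s * v) v 0 := fun u v ↦ by
      simpa using ((hasDerivAt_id (0 : K)).mul_const v).const_add u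
    refine ⟨h, hline h _ (HasDerivAt.prodMk ?_ ?_)⟩ <;>
    refine hasDerivAt_pi.2 fun i ↦ hasDerivAt_pi.2 fun j ↦ ?_
    · rcases j with j | j <;>
      refine (HasDerivAt.fun_sum fun l _ ↦ (hd _ _).fun_mul (hd _ _)).congr_deriv ?_ <;>
      simp [a, h, Finset.sum_add_distrib]
    · rcases j with j | j
      · refine (HasDerivAt.fun_sum fun l _ ↦ ((hd _ _).fun_mul (hd _ _)).fun_mul
          (hd _ _)).congr_deriv ?_
        simp [a, h, Finset.sum_add_distrib, add_mul]
        by_cases hij : i = j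
        · simp only [p, hij, if_true]
          ring
        · have : β j - β i ≠ 0 := sub_ne_zero.2 fun h ↦ hij (hβ h).symm
          simp only [p, hij, if_false]
          field_simp
          ring
      · refine ((HasDerivAt.fun_sum fun l _ ↦ ((hd _ _).fun_mul (hd _ _)).fun_mul
          (hd _ _)).fun_add (hd _ _)).congr_deriv ?_
        simp [a, h]
        ring
  have hfa : f a = (fun i ↦ Sum.elim (fun j ↦ if i = j then 1 else 0) 0,
      fun i ↦ Sum.elim (fun j ↦ if i = j then β i else 0) 0) := by
    refine Prod.ext (funext fun i ↦ funext fun j ↦ ?_) (funext fun i ↦ funext fun j ↦ ?_) <;>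
    rcases j with j | j <;> simp [f, a]
    split_ifs with hij <;> simp [hij]
  rw [← hfa, ← hs.map_nhds_eq_of_surj hsurj, eventually_map]
  refine Eventually.of_forall fun x ↦
    ⟨fun i ↦ Sum.elim (x.1.1 i) (x.2.1 i),
      Sum.elim (fun l ↦ Sum.elim (x.1.2.1 l) (x.2.2 l))
        (fun l ↦ Sum.elim 0 (fun j ↦ if l = j then 1 else 0)),
      Sum.elim 1 0, Sum.elim x.1.2.2 1, ?_, ?_⟩ <;>
  · rintro i (j | j) <;> simp [f]

section Decomposition

variable {K U V V' W : Type*} [Field K] [AddCommGroup U] [Module K U] [AddCommGroup V] [Module K V]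
  [AddCommGroup V'] [Module K V'] [AddCommGroup W] [Module K W]

/-- The trilinear form `T` is a sum of `r` products of linear forms. -/
def HasRankLE (T : U →ₗ[K] V →ₗ[K] W →ₗ[K] K) (r : ℕ) : Prop :=
  ∃ (φ : Fin r → Dual K V) (ψ : Fin r → Dual K W) (χ : Fin r → Dual K U),
    ∀ z x y, T z x y = ∑ i, φ i x * ψ i y * χ i z

theorem HasRankLE.of_fintype {T : U →ₗ[K] V →ₗ[K] W →ₗ[K] K} {ι : Type*} [Fintype ι] {r : ℕ}
    (hr : Fintype.card ι ≤ r) (φ : ι → Dual K V) (ψ : ι → Dual K W) (χ : ι → Dual K U)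
    (h : ∀ z x y, T z x y = ∑ i, φ i x * ψ i y * χ i z) : HasRankLE T r := by
  obtain ⟨k, rfl⟩ := Nat.exists_eq_add_of_le hr
  let g := Fintype.equivFin ι
  refine ⟨Fin.append (φ ∘ g.symm) 0, Fin.append (ψ ∘ g.symm) 0, Fin.append (χ ∘ g.symm) 0,
    fun z x y ↦ ?_⟩
  rw [h, Fin.sum_univ_add, ← g.symm.sum_comp]
  simp

/-- Exchange the last two arguments of a trilinear form. -/
def swapLast (T : U →ₗ[K] V →ₗ[K] W →ₗ[K] K) : U →ₗ[K] W →ₗ[K] V →ₗ[K] K :=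
  LinearMap.lflip.toLinearMap ∘ₗ T

@[simp]
theorem swapLast_apply (T : U →ₗ[K] V →ₗ[K] W →ₗ[K] K) (z : U) (x : V) (y : W) :
    swapLast T z y x = T z x y := rfl

theorem HasRankLE.of_swapLast {T : U →ₗ[K] V →ₗ[K] W →ₗ[K] K} {r : ℕ}
    (h : HasRankLE (swapLast T) r) : HasRankLE T r := by
  obtain ⟨φ, ψ, χ, h⟩ := h
  exact ⟨ψ, φ, χ, fun z x y ↦ by
    rw [← swapLast_apply, h]
    simp only [mul_comm (φ _ _)]⟩

/-- Precompose the second argument of a trilinear form with a linear map. -/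
def compSecond (T : U →ₗ[K] V →ₗ[K] W →ₗ[K] K) (f : V' →ₗ[K] V) : U →ₗ[K] V' →ₗ[K] W →ₗ[K] K :=
  LinearMap.lcomp K _ f ∘ₗ T

@[simp]
theorem compSecond_apply (T : U →ₗ[K] V →ₗ[K] W →ₗ[K] K) (f : V' →ₗ[K] V) (z : U) (x : V') :
    compSecond T f z x = T z (f x) := rfl

/-- The slice of `T` at `w` is a product of two linear forms. -/
def IsProductAt (T : U →ₗ[K] V →ₗ[K] W →ₗ[K] K) (w : V) : Prop :=
  ∃ (ψ : Dual K W) (χ : Dual K U), ∀ z y, T z w y = ψ y * χ z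

/-- Splitting off a direction at which `T` is a product costs one summand. -/
theorem HasRankLE.of_ker {T : U →ₗ[K] V →ₗ[K] W →ₗ[K] K} {w : V} (hw : IsProductAt T w)
    {φ : Dual K V} (hφ : φ w = 1) {r : ℕ}
    (h : HasRankLE (compSecond T (LinearMap.ker φ).subtype) r) : HasRankLE T (r + 1) := by
  obtain ⟨ψ, χ, hw⟩ := hw
  obtain ⟨φ', ψ', χ', h⟩ := h
  let π : V →ₗ[K] LinearMap.ker φ :=
    (LinearMap.id - φ.smulRight w).codRestrict (LinearMap.ker φ) fun x ↦ by simp [hφ]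
  have hπ : ∀ x, x = (π x : V) + φ x • w := fun x ↦
    (sub_add_cancel x (φ x • w)).symm
  refine .of_fintype (ι := Option (Fin r)) (by simp) (fun i ↦ i.elim φ fun i ↦ φ' i ∘ₗ π)
    (fun i ↦ i.elim ψ ψ') (fun i ↦ i.elim χ χ') fun z x y ↦ ?_
  have h1 := h z (π x) y
  simp only [compSecond_apply, Submodule.subtype_apply] at h1
  conv_lhs => rw [hπ x]
  simp [h1, hw, Fintype.sum_option]
  ring

/-- A bilinear form is determined by its values on bases `e` and `x`, the last vector of `x` being
replaced by a vector `y`; if these are the values of `∑ l, φ l ⊗ ψ l` up to diagonal entries, then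
the form is a combination of the `φ l ⊗ ψ l` and of products of dual basis vectors. -/
theorem slice_eq_sum {α κ ι : Type*} [Fintype α] [Fintype κ] [Fintype ι] [DecidableEq α]
    [DecidableEq κ] (S : V →ₗ[K] W →ₗ[K] K)
    (e : Basis α K W) (x : Basis ((α ⊕ κ) ⊕ Unit) K V) (v : α ⊕ κ → K) (hv : ∀ i, v (.inl i) ≠ 0)
    {y : V} (hy : y = x (.inr ()) + ∑ j, v j • x (.inl j))
    (φ : ι → Dual K V) (hφ : ∀ l, φ l y = 0) (ψ : ι → Dual K W) (c : ι → K)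
    (hS : ∀ i j, S (x (.inl j)) (e i) - (if .inl i = j then S y (e i) / v (.inl i) else 0) =
      ∑ l, φ l (x (.inl j)) * ψ l (e i) * c l) (X : V) (Y : W) :
    S X Y = ∑ l, φ l X * ψ l Y * c l +
      ∑ i, x.coord (.inl (.inl i)) X * e.coord i Y * (S y (e i) / v (.inl i)) := by
  let R : V →ₗ[K] W →ₗ[K] K := ∑ l, c l • (φ l).smulRight (ψ l) +
    ∑ i, (S y (e i) / v (.inl i)) • (x.coord (.inl (.inl i))).smulRight (e.coord i)
  have hR : ∀ X Y, R X Y = ∑ l, φ l X * ψ l Y * c l +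
      ∑ i, x.coord (.inl (.inl i)) X * e.coord i Y * (S y (e i) / v (.inl i)) := fun X Y ↦ by
    simp [R, LinearMap.sum_apply, mul_comm, mul_left_comm]
  rw [← hR]
  have hinl : ∀ i j, S (x (.inl j)) (e i) = R (x (.inl j)) (e i) := fun i j ↦ by
    rw [hR, sub_eq_iff_eq_add.1 (hS i j)]
    rcases j with j | j <;> simp [Finsupp.single_apply, eq_comm]
  have hyR : ∀ i, S y (e i) = R y (e i) := fun i ↦ by
    have h1 : ∀ k, x.coord (.inl (.inl k)) y = v (.inl k) := fun k ↦ by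
      rw [hy, map_add, map_sum]
      simp [-Fintype.sum_sum_type, Finsupp.single_apply]
    rw [hR]
    simp only [hφ, h1]
    simp [Finsupp.single_apply, mul_div_cancel₀ _ (hv i)]
  have : S = R := x.ext fun j ↦ e.ext fun i ↦ by
    rcases j with j | ⟨⟩
    · exact hinl i j
    · rw [show x (.inr ()) = y - ∑ j, v j • x (.inl j) by rw [hy]; abel]
      simp [LinearMap.sum_apply, hyR, hinl]
  rw [this]

/-- A trilinear form with slices `C`, `A`, `B`, where `C` is diagonal, has rank at most
`card α + card ι` when `A` and `B`, corrected on the diagonal so as to absorb their values at `y`,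
are simultaneously combinations of `ι` rank-one matrices. -/
theorem hasRankLE_of_pencil {α κ ι : Type*} [Fintype α] [Fintype κ] [Fintype ι] [DecidableEq α]
    [DecidableEq κ] {T : U →ₗ[K] V →ₗ[K] W →ₗ[K] K} {A B C : V →ₗ[K] W →ₗ[K] K}
    {ζ₀ ζ₁ ζ₂ : Dual K U} (hT : ∀ z, T z = ζ₀ z • C + ζ₁ z • A + ζ₂ z • B)
    (e : Basis α K W) (x : Basis ((α ⊕ κ) ⊕ Unit) K V) (γ : α → K)
    (hC : ∀ i j, C (x j) (e i) = if j = .inl (.inl i) then γ i else 0)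
    (v : α ⊕ κ → K) (hv : ∀ i, v (.inl i) ≠ 0)
    {y : V} (hy : y = x (.inr ()) + ∑ j, v j • x (.inl j))
    (P : α → ι → K) (Q : ι → α ⊕ κ → K) (c d : ι → K)
    (hA : ∀ i j, A (x (.inl j)) (e i) - (if .inl i = j then A y (e i) / v (.inl i) else 0) =
      ∑ l, P i l * Q l j * c l)
    (hB : ∀ i j, B (x (.inl j)) (e i) - (if .inl i = j then B y (e i) / v (.inl i) else 0) =
      ∑ l, P i l * Q l j * d l) :
    HasRankLE T (Fintype.card α + Fintype.card ι) := by
  have hCsum : ∀ X Y, C X Y = ∑ i, x.coord (.inl (.inl i)) X * e.coord i Y * γ i := by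
    let R : V →ₗ[K] W →ₗ[K] K :=
      ∑ i, γ i • (x.coord (.inl (.inl i))).smulRight (e.coord i)
    have hR : ∀ X Y, R X Y = ∑ i, x.coord (.inl (.inl i)) X * e.coord i Y * γ i := fun X Y ↦ by
      simp [R, LinearMap.sum_apply, mul_comm]
    have : C = R := x.ext fun j ↦ e.ext fun i ↦ by
      rw [hR, hC]
      simp [Finsupp.single_apply]
    simpa [this] using hR
  obtain ⟨φ, hφ⟩ : ∃ φ : ι → Dual K V, ∀ l, φ l y = 0 ∧ ∀ j, φ l (x (.inl j)) = Q l j := by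
    refine ⟨fun l ↦ x.constr K (Sum.elim (Q l) fun _ ↦ -∑ j, v j * Q l j), fun l ↦ ?_⟩
    refine (and_iff_right_of_imp fun h ↦ ?_).2 fun j ↦ by rw [Basis.constr_basis, Sum.elim_inl]
    rw [hy, map_add, map_sum, Basis.constr_basis]
    simp only [map_smul, h, Sum.elim_inr, smul_eq_mul, neg_add_cancel]
  obtain ⟨ψ, hψ⟩ : ∃ ψ : ι → Dual K W, ∀ l i, ψ l (e i) = P i l :=
    ⟨fun l ↦ e.constr K fun i ↦ P i l, fun l i ↦ by rw [Basis.constr_basis]⟩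
  have hAsum := slice_eq_sum A e x v hv hy φ (fun l ↦ (hφ l).1) ψ c fun i j ↦ by
    simp only [hA, (hφ _).2, hψ, mul_comm (P _ _)]
  have hBsum := slice_eq_sum B e x v hv hy φ (fun l ↦ (hφ l).1) ψ d fun i j ↦ by
    simp only [hB, (hφ _).2, hψ, mul_comm (P _ _)]
  refine .of_fintype (ι := α ⊕ ι) (by simp)
    (Sum.elim (fun i ↦ x.coord (.inl (.inl i))) φ) (Sum.elim e.coord ψ)
    (Sum.elim (fun i ↦ γ i • ζ₀ + (A y (e i) / v (.inl i)) • ζ₁ + (B y (e i) / v (.inl i)) • ζ₂)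
      fun l ↦ c l • ζ₁ + d l • ζ₂) fun z X Y ↦ ?_
  rw [Fintype.sum_sum_type, hT]
  simp only [LinearMap.add_apply, LinearMap.smul_apply, smul_eq_mul, Sum.elim_inl, Sum.elim_inr]
  rw [hCsum, hAsum, hBsum]
  simp only [mul_add, mul_comm _ (ζ₀ z), mul_comm _ (ζ₁ z), mul_comm _ (ζ₂ z),
    mul_left_comm _ (ζ₀ z), mul_left_comm _ (ζ₁ z), mul_left_comm _ (ζ₂ z),
    Finset.sum_add_distrib, ← Finset.mul_sum]
  ring

end Decomposition

section Adapted

variable {K U V W : Type*} [RCLike K] [AddCommGroup U] [Module K U] [AddCommGroup V] [Module K V]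
  [AddCommGroup W] [Module K W]

/-- The rank bound for three slices in normal form: `C` is diagonal, and the values of `A` and `B` at
the last basis vector and at `∑ j, x (.inl (.inl (.inl j)))` are prescribed by `β`. A perturbation
`y` of the last basis vector brings the slices close to a pencil with simple eigenvalues. -/
theorem hasRankLE_of_adapted_bases {σ τ κ : Type*} [Fintype σ] [Fintype τ] [Fintype κ]
    [DecidableEq σ] [DecidableEq τ] [DecidableEq κ]
    {T : U →ₗ[K] V →ₗ[K] W →ₗ[K] K} {A B C : V →ₗ[K] W →ₗ[K] K}
    {ζ₀ ζ₁ ζ₂ : Dual K U} (hT : ∀ z, T z = ζ₀ z • C + ζ₁ z • A + ζ₂ z • B)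
    (e : Basis (σ ⊕ τ) K W) (x : Basis (((σ ⊕ τ) ⊕ κ) ⊕ Unit) K V) (γ : σ ⊕ τ → K)
    (hC : ∀ i j, C (x j) (e i) = if j = .inl (.inl i) then γ i else 0)
    (β : σ ⊕ τ → K) (hβ : Function.Injective β)
    (hAw : ∀ i, A (x (.inr ())) (e i) = Sum.elim (fun _ ↦ 1) (fun _ ↦ 0) i)
    (hBw : ∀ i, B (x (.inr ())) (e i) = Sum.elim (fun i ↦ β (.inl i)) (fun _ ↦ 0) i)
    (hAξ : ∀ i, A (∑ j, x (.inl (.inl (.inl j)))) (e (.inr i)) = 1)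
    (hBξ : ∀ i, B (∑ j, x (.inl (.inl (.inl j)))) (e (.inr i)) = β (.inr i)) :
    HasRankLE T (Fintype.card (σ ⊕ τ) + Fintype.card ((σ ⊕ τ) ⊕ κ)) := by
  set ξ := ∑ j, x (.inl (.inl (.inl j)))
  let η := ∑ j, x (.inl (.inl (.inr j)))
  let D : (V →ₗ[K] W →ₗ[K] K) → (σ ⊕ τ → K) → K → σ ⊕ τ → K := fun S b ε ↦
    Sum.elim (fun i ↦ b (.inl i) + ε * S ξ (e (.inl i)) + ε ^ 2 * S η (e (.inl i)))
      fun i ↦ b (.inr i) + ε * S η (e (.inr i))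
  let G : (V →ₗ[K] W →ₗ[K] K) → (σ ⊕ τ → K) → K → σ ⊕ τ → (σ ⊕ τ) ⊕ κ → K := fun S b ε i j ↦
    (if .inl i = j then D S b ε i else 0) - ε * S (x (.inl j)) (e i)
  have hG : Continuous fun ε ↦ (G A 1 ε, G B β ε) := by
    refine Continuous.prodMk ?_ ?_ <;>
    · refine continuous_pi fun i ↦ continuous_pi fun j ↦ Continuous.sub ?_ (by fun_prop)
      split_ifs
      · rcases i with i | i <;> simp only [D, Sum.elim_inl, Sum.elim_inr] <;> fun_prop
      · fun_prop
  have hlim := hG.tendsto 0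
  have h0 : (G A 1 0, G B β 0) = (fun i ↦ Sum.elim (fun j ↦ if i = j then 1 else 0) 0,
      fun i ↦ Sum.elim (fun j ↦ if i = j then β i else 0) 0) := by
    refine Prod.ext (funext fun i ↦ funext fun j ↦ ?_) (funext fun i ↦ funext fun j ↦ ?_) <;>
    rcases i with i | i <;> rcases j with j | j <;> simp [G, D]
  rw [h0] at hlim
  obtain ⟨ε, ⟨P, Q, c, d, hA, hB⟩, hε⟩ :=
    ((hlim.eventually (eventually_exists_pencil_decomposition β hβ)).filter_mono
      nhdsWithin_le_nhds |>.and (self_mem_nhdsWithin (s := {0}ᶜ))).exists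
  replace hε : ε ≠ 0 := hε
  replace hA : ∀ i j, G A 1 ε i j = ∑ l, P i l * Q l j * c l := hA
  replace hB : ∀ i j, G B β ε i j = ∑ l, P i l * Q l j * d l := hB
  let v : (σ ⊕ τ) ⊕ κ → K := Sum.elim (Sum.elim (fun _ ↦ ε) fun _ ↦ ε ^ 2) 0
  let y := x (.inr ()) + ∑ j, v j • x (.inl j)
  have hy : y = x (.inr ()) + ε • ξ + ε ^ 2 • η := by
    simp [y, v, ξ, η, Finset.smul_sum, add_assoc]
  have key : ∀ (S : V →ₗ[K] W →ₗ[K] K) (b : σ ⊕ τ → K),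
      (∀ i, S (x (.inr ())) (e i) = Sum.elim (fun i ↦ b (.inl i)) (fun _ ↦ 0) i) →
      (∀ i, S ξ (e (.inr i)) = b (.inr i)) → ∀ i j,
      S (x (.inl j)) (e i) - (if .inl i = j then S y (e i) / v (.inl i) else 0) =
        -ε⁻¹ * G S b ε i j := by
    intro S b hw hS i j
    have : ε⁻¹ * D S b ε i = S y (e i) / v (.inl i) := by
      rcases i with i | i <;> simp [D, v, hy, hw, hS] <;> field_simp
    rw [← this]
    simp only [G]
    split_ifs <;> field_simp <;> ring
  refine hasRankLE_of_pencil hT e x γ hC v ?_ rfl (fun i l ↦ -ε⁻¹ * P i l) Q c d ?_ ?_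
  · rintro (i | i) <;> simp [v, hε]
  · intro i j
    rw [key A 1 (by simpa using hAw) (by simpa using hAξ), hA, Finset.mul_sum]
    simp only [mul_assoc]
  · intro i j
    rw [key B β hBw hBξ, hB, Finset.mul_sum]
    simp only [mul_assoc]

end Adapted

section Bases

variable {K V W : Type*} [Field K] [AddCommGroup V] [Module K V] [AddCommGroup W] [Module K W]

theorem LinearIndependent.exists_basis_sum {ι κ : Type*} [Fintype ι] [Fintype κ]
    [FiniteDimensional K V] {v : ι → V} (hv : LinearIndependent K v)
    (h : finrank K V = Fintype.card ι + Fintype.card κ) :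
    ∃ b : Basis (ι ⊕ κ) K V, ∀ i, b (.inl i) = v i := by
  obtain ⟨N, hN⟩ := (Submodule.span K (Set.range v)).exists_isCompl
  have hκ : finrank K N = Fintype.card κ := by
    have := Submodule.finrank_add_eq_of_isCompl hN
    rw [finrank_span_eq_card hv, h] at this
    omega
  let c : Basis κ K N := (finBasisOfFinrankEq K N hκ).reindex (Fintype.equivFin κ).symm
  exact ⟨((Basis.span hv).prod c).map (Submodule.prodEquivOfIsCompl _ _ hN),
    fun i ↦ by simp [Basis.span_apply]⟩

/-- Two independent linear forms take prescribed values `1` and `β i` on the vectors of a suitable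
basis. -/
theorem exists_basis_forall_eq {σ : Type*} [Fintype σ] [DecidableEq σ] [FiniteDimensional K V]
    (hσ : finrank K V = Fintype.card σ) {a b : Dual K V} (hab : LinearIndependent K ![a, b])
    {β : σ → K} (hβ : Function.Injective β) :
    ∃ e : Basis σ K V, (∀ i, a (e i) = 1) ∧ ∀ i, b (e i) = β i := by
  have h2 : 2 ≤ Fintype.card σ := by
    simpa [hσ, Subspace.dual_finrank_eq] using hab.fintype_card_le_finrank
  obtain ⟨k, hk⟩ := Nat.exists_eq_add_of_le h2
  have h1β : LinearIndependent K ![(1 : σ → K), β] := by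
    rw [LinearIndependent.pair_iff]
    intro s t hst
    obtain ⟨i, j, hij⟩ := Fintype.one_lt_card_iff.1 h2
    have hi := congr_fun hst i
    have hj := congr_fun hst j
    simp only [Pi.add_apply, Pi.smul_apply, Pi.one_apply, smul_eq_mul, mul_one,
      Pi.zero_apply] at hi hj
    have ht : t = 0 := by
      refine (mul_eq_zero.1 ?_).resolve_right (sub_ne_zero.2 fun h ↦ hij (hβ h))
      linear_combination hi - hj
    exact ⟨by simpa [ht] using hi, ht⟩
  obtain ⟨b₁, hb₁⟩ := hab.exists_basis_sum (κ := Fin k) (by simp [Subspace.dual_finrank_eq, hσ, hk])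
  obtain ⟨b₂, hb₂⟩ := h1β.exists_basis_sum (κ := Fin k) (by simp [hk])
  let Ψ : Dual K V ≃ₗ[K] (σ → K) := b₁.equiv b₂ (.refl _)
  have hΨ : ∀ i, Ψ (![a, b] i) = ![1, β] i := fun i ↦ by
    rw [← hb₁, ← hb₂]
    simp [Ψ]
  let e : Basis σ K V :=
    (((Pi.basisFun K σ).dualBasis.map Ψ.dualMap)).map (evalEquiv K V).symm
  have he : ∀ f i, f (e i) = Ψ f i := fun f i ↦ by
    simp [e]
  exact ⟨e, fun i ↦ by rw [he, show Ψ a = 1 from hΨ 0, Pi.one_apply],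
    fun i ↦ by rw [he, show Ψ b = β from hΨ 1]⟩

theorem Module.Dual.eq_zero_or_eq_zero_of_mul [Infinite K] {f g : Dual K V}
    (h : ∀ x, f x * g x = 0) : f = 0 ∨ g = 0 := by
  by_contra! hfg
  obtain ⟨x, hx⟩ := Module.Dual.exists_forall_ne_zero_of_forall_exists ![f, g] fun i ↦ by
    fin_cases i
    · exact DFunLike.ne_iff.1 hfg.1
    · exact DFunLike.ne_iff.1 hfg.2
  exact (mul_ne_zero (hx 0) (hx 1)) (h x)

/-- If all pairs of slices `A · u`, `B · u` are independent, then so is some pair `A x`, `B x`. -/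
theorem exists_minor_ne_zero [Infinite K] (A B : V →ₗ[K] W →ₗ[K] K)
    (h : ∀ u, u ≠ 0 → LinearIndependent K ![A.flip u, B.flip u]) (hW : 1 < finrank K W) :
    ∃ x u v, A x u * B x v - A x v * B x u ≠ 0 := by
  by_contra! hAB
  have : Nontrivial W := nontrivial_of_finrank_pos (zero_lt_one.trans hW)
  obtain ⟨u, hu⟩ := exists_ne (0 : W)
  obtain ⟨v, hv⟩ := exists_linearIndependent_pair_of_one_lt_finrank hW hu
  have hp : A.flip u ≠ 0 := (h u hu).ne_zero 0
  obtain ⟨x₁, hx₁⟩ : ∃ x₁, A x₁ u = 1 := by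
    obtain ⟨x, hx⟩ := DFunLike.ne_iff.1 hp
    replace hx : A x u ≠ 0 := hx
    exact ⟨(A x u)⁻¹ • x, by simp [hx]⟩
  have hker : ∀ f : Dual K V, (∀ x, A x u = 0 → f x = 0) → f = f x₁ • A.flip u := by
    intro f hf
    ext x
    have := hf (x - A x u • x₁) (by simp [hx₁])
    simp only [map_sub, map_smul, sub_eq_zero, smul_eq_mul] at this
    simp [this, mul_comm]
  have hpv : A.flip v = A x₁ v • A.flip u := by
    refine hker (A.flip v) fun x hx ↦ ?_
    rcases Module.Dual.eq_zero_or_eq_zero_of_mul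
      (f := (A.flip v).domRestrict (LinearMap.ker (A.flip u)))
      (g := (B.flip u).domRestrict (LinearMap.ker (A.flip u))) fun x ↦ by
        have h1 : A (x : V) u = 0 := x.2
        have := hAB x u v
        simpa [h1] using this with h0 | h0
    · exact LinearMap.congr_fun h0 ⟨x, hx⟩
    · have h1 := hker (B.flip u) fun x hx ↦ LinearMap.congr_fun h0 ⟨x, hx⟩
      have := LinearIndependent.pair_iff.1 (h u hu) (-(B.flip u x₁)) 1 (by
        rw [one_smul]
        nth_rw 2 [h1]
        simp)
      exact absurd this.2 one_ne_zero
  have hqv : B.flip v = A x₁ v • B.flip u := by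
    refine sub_eq_zero.1 ((Module.Dual.eq_zero_or_eq_zero_of_mul (f := A.flip u) fun x ↦ ?_)
      |>.resolve_left hp)
    have h1 : A x v = A x₁ v * A x u := LinearMap.congr_fun hpv x
    have := hAB x u v
    simp only [LinearMap.flip_apply, LinearMap.sub_apply, LinearMap.smul_apply, smul_eq_mul]
    rw [h1] at this
    linear_combination this
  have h0 : v - A x₁ v • u ≠ 0 := fun h0 ↦ by
    have := LinearIndependent.pair_iff.1 hv (-(A x₁ v)) 1 (by rw [← h0]; module)
    exact one_ne_zero this.2
  refine (h _ h0).ne_zero 0 ?_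
  simp [hpv]

end Bases

section RowBasis

variable {K V W : Type*} [RCLike K] [AddCommGroup V] [Module K V] [AddCommGroup W] [Module K W]

/-- If all pairs of slices `A · u`, `B · u` are independent, then for some generic `x` the forms
`A x` and `B x` take values `1` and `β' i` on the vectors of a basis, with distinct `β' i`. -/
theorem exists_basis_forall_slice_eq [FiniteDimensional K W] (A B : V →ₗ[K] W →ₗ[K] K)
    (h : ∀ u, u ≠ 0 → LinearIndependent K ![A.flip u, B.flip u]) {σ τ : Type*} [Fintype σ]
    [Fintype τ] [DecidableEq τ] (hτ : finrank K W = Fintype.card τ)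
    (f : σ → Dual K V) (hf : ∀ i, f i ≠ 0) {β : σ → K} (hβ : Function.Injective β) :
    ∃ (x : V) (e : Basis τ K W) (β' : τ → K), (∀ i, f i x ≠ 0) ∧
      Function.Injective (Sum.elim β β') ∧ (∀ i, A x (e i) = 1) ∧ ∀ i, B x (e i) = β' i := by
  obtain ⟨x₀, hx₀⟩ := Module.Dual.exists_forall_ne_zero_of_forall_exists f
    fun i ↦ DFunLike.ne_iff.1 (hf i)
  let e₀ : Basis τ K W := (finBasisOfFinrankEq K W hτ).reindex (Fintype.equivFin τ).symm
  rcases lt_trichotomy (Fintype.card τ) 1 with h0 | h1 | h2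
  · have : IsEmpty τ := Fintype.card_eq_zero_iff.1 (by omega)
    exact ⟨x₀, e₀, isEmptyElim, hx₀, hβ.sumElim (Function.injective_of_subsingleton _)
      fun _ b ↦ isEmptyElim b, fun i ↦ isEmptyElim i, fun i ↦ isEmptyElim i⟩
  · obtain ⟨t, ht⟩ := Fintype.card_eq_one_iff.1 h1
    have hind := h (e₀ t) (e₀.ne_zero t)
    let g : Option σ → Dual K V := fun i ↦
      i.elim (A.flip (e₀ t)) fun i ↦ B.flip (e₀ t) - β i • A.flip (e₀ t)
    have hg : ∀ i, Sum.elim f g i ≠ 0 := by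
      rintro (i | _ | i)
      · exact hf i
      · exact hind.ne_zero 0
      · intro h0
        have := LinearIndependent.pair_iff.1 hind (-(β i)) 1 (by
          rw [← h0, show Sum.elim f g (.inr (some i)) = B.flip (e₀ t) - β i • A.flip (e₀ t) from rfl]
          module)
        exact one_ne_zero this.2
    obtain ⟨x, hx⟩ := Module.Dual.exists_forall_ne_zero_of_forall_exists (Sum.elim f g)
      fun i ↦ DFunLike.ne_iff.1 (hg i)
    have hA : A x (e₀ t) ≠ 0 := hx (.inr none)
    refine ⟨x, e₀.isUnitSMul (w := fun _ ↦ (A x (e₀ t))⁻¹) fun _ ↦ (inv_ne_zero hA).isUnit,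
      fun _ ↦ (A x (e₀ t))⁻¹ * B x (e₀ t), fun i ↦ hx (.inl i),
      hβ.sumElim (fun i j _ ↦ (ht i).trans (ht j).symm) fun i _ h0 ↦ ?_, fun i ↦ ?_, fun i ↦ ?_⟩
    · refine hx (.inr (some i)) ?_
      simp only [g, Sum.elim_inr, Option.elim_some, LinearMap.sub_apply, LinearMap.smul_apply,
        LinearMap.flip_apply, h0, smul_eq_mul]
      field_simp
      simp
    · simp [Basis.isUnitSMul_apply, ht i, hA]
    · simp [Basis.isUnitSMul_apply, ht i]
  · obtain ⟨x₁, u, v, hx₁⟩ := exists_minor_ne_zero A B h (hτ ▸ h2)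
    have hev : ∀ᶠ s : K in 𝓝[≠] 0, A (x₁ + s • x₀) u * B (x₁ + s • x₀) v -
        A (x₁ + s • x₀) v * B (x₁ + s • x₀) u ≠ 0 := by
      refine (ContinuousAt.eventually_ne ?_ ?_).filter_mono nhdsWithin_le_nhds
      · simp only [map_add, map_smul, LinearMap.add_apply, LinearMap.smul_apply]
        fun_prop
      · simpa using hx₁
    have hev' : ∀ᶠ s : K in 𝓝[≠] 0, ∀ i, f i (x₁ + s • x₀) ≠ 0 := by
      refine eventually_all.2 fun i ↦ ?_
      by_cases h0 : f i x₁ = 0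
      · filter_upwards [self_mem_nhdsWithin] with s hs
        simpa [h0, hx₀ i] using hs
      · refine (ContinuousAt.eventually_ne ?_ ?_).filter_mono nhdsWithin_le_nhds
        · simp only [map_add, map_smul]
          fun_prop
        · simpa using h0
    obtain ⟨s, hs, hs'⟩ := (hev.and hev').exists
    set x := x₁ + s • x₀
    have hind : LinearIndependent K ![A x, B x] := by
      refine LinearIndependent.pair_iff.2 fun p q hpq ↦ ?_
      have hu := LinearMap.congr_fun hpq u
      have hv := LinearMap.congr_fun hpq v
      simp only [LinearMap.add_apply, LinearMap.smul_apply, smul_eq_mul,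
        LinearMap.zero_apply] at hu hv
      constructor <;> refine (mul_eq_zero.1 ?_).resolve_right hs
      · linear_combination B x v * hu - B x u * hv
      · linear_combination A x u * hv - A x v * hu
    have := (Set.finite_range β).infinite_compl.to_subtype
    let ν := Infinite.natEmbedding ↥(Set.range β)ᶜ
    let g : τ → K := fun i ↦ ν (Fintype.equivFin τ i)
    have hg : Function.Injective g := fun i j hij ↦
      (Fintype.equivFin τ).injective (Fin.ext (ν.injective (Subtype.ext hij)))
    obtain ⟨e, hA, hB⟩ := exists_basis_forall_eq hτ hind hg
    exact ⟨x, e, g, hs', hβ.sumElim hg fun i j hij ↦ (ν (Fintype.equivFin τ j)).2 ⟨i, hij⟩, hA, hB⟩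

end RowBasis

section Independent

variable {K U V W : Type*} [RCLike K] [AddCommGroup U] [Module K U] [AddCommGroup V] [Module K V]
  [AddCommGroup W] [Module K W]

/-- The rank bound for three slices `C`, `A`, `B` such that `A w` and `B w` are linearly independent
for some `w` in the kernel of `C`, and likewise for all vectors killed by `C` on the other side. -/
theorem hasRankLE_of_linearIndependent_slices [FiniteDimensional K V] [FiniteDimensional K W]
    {T : U →ₗ[K] V →ₗ[K] W →ₗ[K] K} {A B C : V →ₗ[K] W →ₗ[K] K}
    {ζ₀ ζ₁ ζ₂ : Dual K U} (hT : ∀ z, T z = ζ₀ z • C + ζ₁ z • A + ζ₂ z • B)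
    {w : V} (hCw : C w = 0) (hAw : A w ∈ LinearMap.range C) (hBw : B w ∈ LinearMap.range C)
    (hw : LinearIndependent K ![A w, B w])
    (hL : ∀ u, u ≠ 0 → (∀ x, C x u = 0) → LinearIndependent K ![A.flip u, B.flip u])
    (hVW : finrank K W < finrank K V) : HasRankLE T (finrank K W + finrank K V - 1) := by
  let L : Submodule K W := (LinearMap.range C).dualCoannihilator
  have hmemL : ∀ u, u ∈ L ↔ ∀ x, C x u = 0 := fun u ↦ by
    simp only [L, Submodule.mem_dualCoannihilator, LinearMap.mem_range, forall_exists_index,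
      forall_apply_eq_imp_iff]
  have hrange : ∀ f : Dual K W, (∀ u ∈ L, f u = 0) → f ∈ LinearMap.range C := fun f hf ↦ by
    rw [← Subspace.dualCoannihilator_dualAnnihilator_eq (W := LinearMap.range C)]
    exact (Submodule.mem_dualAnnihilator _).2 hf
  have hrange' : ∀ f ∈ LinearMap.range C, ∀ u ∈ L, f u = 0 := by
    rintro _ ⟨x, rfl⟩ u hu
    exact (hmemL u).1 hu x
  obtain ⟨M, hM⟩ := L.exists_isCompl
  have hdim₁ : finrank K (LinearMap.range C) + finrank K L = finrank K W :=
    Subspace.finrank_add_finrank_dualCoannihilator_eq _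
  have hdim₂ := Submodule.finrank_add_eq_of_isCompl hM
  have hdim₃ := C.finrank_range_add_finrank_ker
  have hwM : LinearIndependent K ![(A w).domRestrict M, (B w).domRestrict M] := by
    refine LinearIndependent.pair_iff.2 fun s t hst ↦ LinearIndependent.pair_iff.1 hw s t ?_
    ext u
    obtain ⟨l, hl, k, hk, rfl⟩ := Submodule.mem_sup.1 (hM.sup_eq_top ▸ Submodule.mem_top : u ∈ L ⊔ M)
    have hk' := LinearMap.congr_fun hst ⟨k, hk⟩
    simp only [LinearMap.add_apply, LinearMap.smul_apply, LinearMap.domRestrict_apply] at hk'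
    simp [hrange' _ hAw l hl, hrange' _ hBw l hl, -smul_eq_mul, hk']
  obtain ⟨eM, hAM, hBM⟩ := exists_basis_forall_eq (finrank_eq_card_basis (finBasis K M)) hwM
    (β := fun i ↦ (i : K)) (Nat.cast_injective.comp Fin.val_injective)
  replace hAM : ∀ i, A w (eM i : W) = 1 := hAM
  replace hBM : ∀ i, B w (eM i : W) = i := hBM
  obtain ⟨ξ, eL, β', hξ, hβ, hAL, hBL⟩ := exists_basis_forall_slice_eq
    (A.compl₂ L.subtype) (B.compl₂ L.subtype) (fun u hu ↦ by
      have := hL u (by simpa using hu) ((hmemL u).1 u.2)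
      exact this)
    (finrank_eq_card_basis (finBasis K L)) (fun i ↦ C.flip (eM i : W)) (fun i h0 ↦ by
      have : (eM i : W) ∈ L := (hmemL _).2 fun x ↦ LinearMap.congr_fun h0 x
      exact eM.ne_zero i (Subtype.ext (Submodule.disjoint_def.1 hM.disjoint _ this (eM i).2)))
    (β := fun i ↦ (i : K)) (Nat.cast_injective.comp Fin.val_injective)
  let e : Basis _ K W := (eM.prod eL).map (Submodule.prodEquivOfIsCompl M L hM.symm)
  have hel : ∀ i, e (.inl i) = eM i := fun i ↦ by simp [e]
  have her : ∀ i, e (.inr i) = eL i := fun i ↦ by simp [e]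
  have hcoord : ∀ j, e.coord (.inl j) ∈ LinearMap.range C := fun j ↦ hrange _ fun u hu ↦ by
    have := Submodule.prodEquivOfIsCompl_symm_apply_right M L hM.symm ⟨u, hu⟩
    simp only at this
    simp [e, this]
  have hCr : ∀ x i, C x (e (.inr i)) = 0 := fun x i ↦ by
    rw [her]
    exact (hmemL _).1 (eL i).2 x
  choose y hy using fun j ↦ Submodule.smul_mem _ (C ξ (e (.inl j))) (hcoord j)
  have hCy : C (ξ - ∑ j, y j) = 0 := e.ext fun i ↦ by
    rcases i with i | i
    · simp [LinearMap.sum_apply, hy, Finsupp.single_apply]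
    · exact hCr _ _
  have hdimM : 2 ≤ finrank K M := by
    simpa [Subspace.dual_finrank_eq] using hwM.fintype_card_le_finrank
  let x' : Fin (finrank K M) → V := fun j ↦
    y j + if j = ⟨0, by omega⟩ then ξ - ∑ j, y j else 0
  have hx'ξ : ∑ j, x' j = ξ := by simp [x', Finset.sum_add_distrib]
  have hCx' : ∀ j, C (x' j) = C ξ (e (.inl j)) • e.coord (.inl j) := fun j ↦ by
    rw [← hy, ← sub_eq_zero, ← map_sub]
    simp only [x', add_sub_cancel_left]
    split_ifs <;> simp [hCy]
  have hw0 : (⟨w, hCw⟩ : LinearMap.ker C) ≠ 0 := fun h0 ↦ hw.ne_zero 0 (by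
    simp [show w = 0 from congrArg Subtype.val h0])
  obtain ⟨b, hb⟩ := (LinearIndependent.of_subsingleton (R := K)
    (v := fun _ : Unit ↦ (⟨w, hCw⟩ : LinearMap.ker C)) ()
    hw0).exists_basis_sum
      (κ := Fin (finrank K L) ⊕ Fin (finrank K V - finrank K W - 1)) (by simp; omega)
  have hind : LinearIndependent K (Sum.elim (fun i ↦ (b i : V)) x') := by
    refine b.linearIndependent.sumElim_of_quotient _ (.of_comp ((LinearMap.ker C).liftQ C le_rfl) ?_)
    let c : Fin (finrank K M) → Kˣ := fun j ↦
      Units.mk0 (C ξ (e (.inl j))) (by rw [hel]; exact hξ j)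
    have h1 := (e.dualBasis.linearIndependent.comp _ Sum.inl_injective).units_smul c
    suffices h2 : LinearIndependent K fun j ↦ C (x' j) from h2
    rw [funext hCx']
    have h2 : (fun j ↦ C ξ (e (.inl j)) • e.coord (.inl j)) = c • (e.dualBasis ∘ Sum.inl) :=
      funext fun j ↦ by simp [c, Units.smul_def]
    exact h2 ▸ h1
  let E : (Unit ⊕ (Fin (finrank K L) ⊕ Fin (finrank K V - finrank K W - 1))) ⊕ Fin (finrank K M) ≃
      ((Fin (finrank K M) ⊕ Fin (finrank K L)) ⊕ Fin (finrank K V - finrank K W - 1)) ⊕ Unit :=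
    (Equiv.sumComm _ _).trans <| (Equiv.sumCongr (.refl _) (Equiv.sumComm _ _)).trans <|
      (Equiv.sumAssoc _ _ _).symm.trans <| Equiv.sumCongr (Equiv.sumAssoc _ _ _).symm (.refl _)
  let x := (basisOfLinearIndependentOfCardEqFinrank hind (by simp; omega)).reindex E
  have hxσ : ∀ j, x (.inl (.inl (.inl j))) = x' j := fun j ↦ by simp [x, E]
  have hxτ : ∀ j, x (.inl (.inl (.inr j))) = b (.inr (.inl j)) := fun j ↦ by simp [x, E]
  have hxκ : ∀ j, x (.inl (.inr j)) = b (.inr (.inr j)) := fun j ↦ by simp [x, E]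
  have hxw : x (.inr ()) = w := by simp [x, E, hb]
  have := hasRankLE_of_adapted_bases hT e x (Sum.elim (fun i ↦ C ξ (e (.inl i))) 0) ?_ _ hβ
    (by rintro (i | i) <;> simp [hxw, hel, her, hAM, hrange' _ hAw])
    (by rintro (i | i) <;> simp [hxw, hel, her, hBM, hrange' _ hBw])
    (fun i ↦ by simp only [hxσ, hx'ξ, her]; exact hAL i)
    (fun i ↦ by simp only [hxσ, hx'ξ, her]; exact hBL i)
  · convert this using 1
    simp
    omega
  · have hb0 : ∀ i, C (b i) = 0 := fun i ↦ (b i).2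
    rintro (i | i) (((j | j) | j) | ⟨⟩) <;>
      simp [hxσ, hxτ, hxκ, hxw, hCx', hb0, hCw, Finsupp.single_apply]
    rcases eq_or_ne i j with rfl | hij
    · rfl
    · simp [hij, hij.symm]

end Independent

section MaximalRank

variable {K V E : Type*} [RCLike K] [AddCommGroup V] [Module K V] [AddCommGroup E] [Module K E]
  [FiniteDimensional K E]

theorem LinearIndependent.eventually_add_smul {ι : Type*} [Finite ι] {v : ι → E}
    (hv : LinearIndependent K v) (w : ι → E) :
    ∀ᶠ ε : K in 𝓝 0, LinearIndependent K fun i ↦ v i + ε • w i := by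
  let g := (finBasis K E).equivFun
  have hg : ∀ u : ι → E, LinearIndependent K (fun i ↦ g (u i)) ↔ LinearIndependent K u :=
    fun u ↦ LinearMap.linearIndependent_iff g.toLinearMap g.ker
  have hcont : Continuous fun (ε : K) i ↦ g (v i) + ε • g (w i) := by fun_prop
  have hopen : IsOpen {u : ι → Fin (finrank K E) → K | LinearIndependent K u} :=
    isOpen_setOfPred_linearIndependent
  filter_upwards [hcont.continuousAt.eventually_mem (x := 0)
    (hopen.mem_nhds (by simpa using (hg v).2 hv))] with ε hε
  rw [← hg]
  simpa using hε

theorem exists_linearIndependent_apply (C : V →ₗ[K] E) :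
    ∃ x : Fin (finrank K (LinearMap.range C)) → V, LinearIndependent K (fun i ↦ C (x i)) ∧
      ∀ f ∈ Submodule.span K (Set.range fun i ↦ C (x i)), f ∈ LinearMap.range C := by
  choose x hx using fun i ↦ LinearMap.mem_range.1 (finBasis K (LinearMap.range C) i).property
  refine ⟨x, ?_, fun f hf ↦ Submodule.span_le.2 (Set.range_subset_iff.2 fun i ↦ ?_) hf⟩
  on_goal 2 => exact ⟨x i, rfl⟩
  simp only [hx]
  exact (finBasis K (LinearMap.range C)).linearIndependent.map' _ (Submodule.ker_subtype _)

theorem LinearIndependent.card_le_finrank_range {ι : Type*} [Fintype ι] {C : V →ₗ[K] E} {v : ι → E}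
    (hv : LinearIndependent K v) (h : ∀ i, v i ∈ LinearMap.range C) :
    Fintype.card ι ≤ finrank K (LinearMap.range C) :=
  (LinearIndependent.of_comp (v := fun i ↦ (⟨v i, h i⟩ : LinearMap.range C))
    (LinearMap.range C).subtype hv).fintype_card_le_finrank

theorem eventually_finrank_range_le (C D : V →ₗ[K] E) :
    ∀ᶠ ε : K in 𝓝 0,
      finrank K (LinearMap.range C) ≤ finrank K (LinearMap.range (C + ε • D)) := by
  obtain ⟨x, hx, -⟩ := exists_linearIndependent_apply C
  filter_upwards [hx.eventually_add_smul fun i ↦ D (x i)] with ε hε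
  simpa using hε.card_le_finrank_range (C := C + ε • D) fun i ↦ ⟨x i, rfl⟩

/-- If `C` has maximal rank in the pencil `C + ε • D`, then `D` maps the kernel of `C` into the range
of `C`. -/
theorem mem_range_of_forall_finrank_range_le {C D : V →ₗ[K] E}
    (h : ∀ ε : K, finrank K (LinearMap.range (C + ε • D)) ≤ finrank K (LinearMap.range C))
    {w : V} (hw : C w = 0) : D w ∈ LinearMap.range C := by
  by_contra hD
  obtain ⟨x, hx, hspan⟩ := exists_linearIndependent_apply C
  have h1 := (hx.option fun h ↦ hD (hspan _ h)).eventually_add_smul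
    fun o ↦ o.casesOn' 0 fun i ↦ D (x i)
  obtain ⟨ε, hε, hε0⟩ :=
    ((h1.filter_mono nhdsWithin_le_nhds).and (self_mem_nhdsWithin (s := {0}ᶜ))).exists
  replace hε0 : ε ≠ 0 := hε0
  have := hε.card_le_finrank_range (C := C + ε • D) fun o ↦ by
    rcases o with _ | i
    · exact ⟨ε⁻¹ • w, by simp [hw, hε0]⟩
    · exact ⟨x i, rfl⟩
  simp only [Fintype.card_option, Fintype.card_fin] at this
  have := h ε
  omega

end MaximalRank

section Reduction

variable {K U V V' W : Type*} [Field K] [AddCommGroup U] [Module K U] [AddCommGroup V] [Module K V]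
  [AddCommGroup V'] [Module K V'] [AddCommGroup W] [Module K W]

theorem HasRankLE.compSecond {T : U →ₗ[K] V →ₗ[K] W →ₗ[K] K} {r : ℕ} (h : HasRankLE T r)
    (f : V' →ₗ[K] V) : HasRankLE (compSecond T f) r := by
  obtain ⟨φ, ψ, χ, h⟩ := h
  exact ⟨fun i ↦ φ i ∘ₗ f, ψ, χ, fun z x y ↦ h z (f x) y⟩

theorem linearIndependent_of_not_isProductAt {T : U →ₗ[K] V →ₗ[K] W →ₗ[K] K}
    {A B C : V →ₗ[K] W →ₗ[K] K} {ζ₀ ζ₁ ζ₂ : Dual K U}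
    (hT : ∀ z, T z = ζ₀ z • C + ζ₁ z • A + ζ₂ z • B) {w : V} (hC : C w = 0)
    (hw : ¬IsProductAt T w) : LinearIndependent K ![A w, B w] := by
  refine LinearIndependent.pair_iff.2 fun s t hst ↦ ?_
  by_contra! hne
  refine hw ?_
  by_cases hs : s = 0
  · have hB : B w = 0 := by simpa [hs, hne hs] using hst
    exact ⟨A w, ζ₁, fun z y ↦ by simp [hT, hC, hB, mul_comm]⟩
  · have hA : A w = -(s⁻¹ * t) • B w := by
      calc A w = s⁻¹ • (s • A w + t • B w) + -(s⁻¹ * t) • B w := by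
            rw [smul_add, inv_smul_smul₀ hs]
            module
        _ = _ := by rw [hst, smul_zero, zero_add]
    refine ⟨B w, ζ₂ - (s⁻¹ * t) • ζ₁, fun z y ↦ ?_⟩
    simp [hT, hC, hA]
    ring

theorem IsProductAt.of_finrank_eq_one (T : U →ₗ[K] V →ₗ[K] W →ₗ[K] K) (hW : finrank K W = 1)
    (w : V) : IsProductAt T w := by
  have : FiniteDimensional K W := .of_finrank_pos (hW ▸ one_pos)
  let e := finBasisOfFinrankEq K W hW
  refine ⟨e.coord 0, (T.flip w).flip (e 0), fun z y ↦ ?_⟩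
  conv_lhs => rw [← e.sum_repr y]
  simp

theorem exists_slices_eq (hU : finrank K U = 3) (T : U →ₗ[K] V →ₗ[K] W →ₗ[K] K) {z₀ : U}
    (hz₀ : z₀ ≠ 0) : ∃ (z₁ z₂ : U) (ζ₀ ζ₁ ζ₂ : Dual K U),
      ∀ z, T z = ζ₀ z • T z₀ + ζ₁ z • T z₁ + ζ₂ z • T z₂ := by
  have : FiniteDimensional K U := FiniteDimensional.of_finrank_pos (by omega)
  obtain ⟨b, hb⟩ := (LinearIndependent.of_subsingleton (R := K) (v := fun _ : Unit ↦ z₀) ()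
    hz₀).exists_basis_sum (κ := Fin 2) (by simp [hU])
  refine ⟨b (.inr 0), b (.inr 1), b.coord (.inl ()), b.coord (.inr 0), b.coord (.inr 1),
    fun z ↦ ?_⟩
  conv_lhs => rw [← b.sum_repr z, map_sum]
  simp [hb, add_assoc]

theorem HasRankLE.of_finrank_ker [FiniteDimensional K V]
    {T : U →ₗ[K] V →ₗ[K] W →ₗ[K] K} {w : V} (hw : IsProductAt T w)
    (hw0 : w ≠ 0) {r : ℕ} (h : ∀ N : Submodule K V, finrank K N + 1 = finrank K V →
      HasRankLE (_root_.compSecond T N.subtype) r) : HasRankLE T (r + 1) := by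
  obtain ⟨φ, hφ⟩ := Module.Projective.exists_dual_eq_one K hw0
  refine .of_ker hw hφ (h _ (Module.Dual.finrank_ker_add_one_of_ne_zero ?_))
  rintro rfl
  simp at hφ

end Reduction

section ThreeSlices

universe u

variable {K U : Type*} {V W : Type u} [RCLike K] [AddCommGroup U] [Module K U] [AddCommGroup V]
  [Module K V] [AddCommGroup W] [Module K W] [FiniteDimensional K V] [FiniteDimensional K W]

/-- The rank bound when a slice `T z₀` of maximal rank kills a vector at which `T` is not a
product. -/
theorem hasRankLE_of_not_isProductAt (hU : finrank K U = 3) {T : U →ₗ[K] V →ₗ[K] W →ₗ[K] K}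
    {z₀ : U} (hz₀ : ∀ z, finrank K (LinearMap.range (T z)) ≤ finrank K (LinearMap.range (T z₀)))
    {w : V} (hw : T z₀ w = 0) (hTw : ¬IsProductAt T w)
    (hrow : ∀ u, u ≠ 0 → ¬IsProductAt (swapLast T) u) (hVW : finrank K W < finrank K V) :
    HasRankLE T (finrank K W + finrank K V - 1) := by
  have hne : z₀ ≠ 0 := by
    rintro rfl
    refine hTw ⟨0, 0, fun z y ↦ ?_⟩
    have := hz₀ z
    rw [map_zero, LinearMap.range_zero, finrank_bot, Nat.le_zero, Submodule.finrank_eq_zero,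
      LinearMap.range_eq_bot] at this
    simp [this]
  obtain ⟨z₁, z₂, ζ₀, ζ₁, ζ₂, hT⟩ := exists_slices_eq hU T hne
  have hmem : ∀ z, T z w ∈ LinearMap.range (T z₀) := fun z ↦
    mem_range_of_forall_finrank_range_le
      (fun ε ↦ by rw [← map_smul, ← map_add]; exact hz₀ _) hw
  refine hasRankLE_of_linearIndependent_slices hT hw (hmem z₁) (hmem z₂)
    (linearIndependent_of_not_isProductAt hT hw hTw) (fun u hu hCu ↦ ?_) hVW
  refine linearIndependent_of_not_isProductAt (T := swapLast T) (C := (T z₀).flip) (ζ₀ := ζ₀)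
    (ζ₁ := ζ₁) (ζ₂ := ζ₂) (fun z ↦ ?_) (LinearMap.ext hCu) (hrow u hu)
  ext y x
  simp [hT z]

/-- The rank bound when all slices kill a common vector and some slice is of full rank. -/
theorem hasRankLE_of_range_eq_top (hU : finrank K U = 3) {T : U →ₗ[K] V →ₗ[K] W →ₗ[K] K}
    {z₀ : U} (hz₀ : LinearMap.range (T z₀) = ⊤) {w : V} (hw : w ≠ 0) (hTw : ∀ z, T z w = 0)
    (hW : 1 < finrank K W) (hVW : finrank K W < finrank K V) :
    HasRankLE T (finrank K W + finrank K V - 1) := by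
  have : Nontrivial (Dual K W) :=
    nontrivial_of_finrank_pos (R := K) (by rw [Subspace.dual_finrank_eq]; omega)
  have hne : z₀ ≠ 0 := by
    rintro rfl
    rw [map_zero, LinearMap.range_zero] at hz₀
    exact bot_ne_top hz₀
  obtain ⟨z₁, z₂, ζ₀, ζ₁, ζ₂, hT⟩ := exists_slices_eq hU T hne
  obtain ⟨ψ₁, hψ₁⟩ := exists_ne (0 : Dual K W)
  obtain ⟨ψ₂, hψ⟩ := exists_linearIndependent_pair_of_one_lt_finrank (R := K)
    (by rwa [Subspace.dual_finrank_eq]) hψ₁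
  obtain ⟨φ, hφ⟩ := Module.Projective.exists_dual_eq_one K hw
  let T' : U →ₗ[K] V →ₗ[K] W →ₗ[K] K :=
    ζ₀.smulRight (T z₀) + ζ₁.smulRight (T z₁ + φ.smulRight ψ₁) +
      ζ₂.smulRight (T z₂ + φ.smulRight ψ₂)
  have h := hasRankLE_of_linearIndependent_slices (T := T') (fun z ↦ rfl) (hTw z₀)
    (hz₀ ▸ Submodule.mem_top) (hz₀ ▸ Submodule.mem_top) (by simpa [hTw, hφ] using hψ)
    (fun u hu hCu ↦ absurd ((Module.forall_dual_apply_eq_zero_iff K u).1 fun f ↦ by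
      obtain ⟨x, rfl⟩ := LinearMap.range_eq_top.1 hz₀ f
      exact hCu x) hu) hVW
  convert h.compSecond (LinearMap.id - φ.smulRight w) using 1
  ext z x y
  simp [T', hT z, hTw, hφ]

/-- A trilinear form on spaces of dimensions `3`, `n`, `m` with `m < n` is a sum of `m + n - 1`
products of linear forms. -/
theorem hasRankLE_of_finrank_eq_three (hU : finrank K U = 3) (T : U →ₗ[K] V →ₗ[K] W →ₗ[K] K)
    (hVW : finrank K W < finrank K V) : HasRankLE T (finrank K W + finrank K V - 1) := by
  obtain ⟨N, hN⟩ : ∃ N, finrank K W + finrank K V = N := ⟨_, rfl⟩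
  induction N using Nat.strong_induction_on generalizing V W with
  | _ N ih =>
  subst hN
  rcases Nat.eq_zero_or_pos (finrank K W) with hW | hW
  · have := finrank_zero_iff.1 hW
    exact .of_fintype (ι := Empty) (by simp) nofun nofun nofun fun z x y ↦ by
      simp [Subsingleton.elim y 0]
  by_cases hrow : ∃ u, u ≠ 0 ∧ IsProductAt (swapLast T) u
  · obtain ⟨u, hu, hTu⟩ := hrow
    have := HasRankLE.of_finrank_ker (r := finrank K W - 1 + finrank K V - 1) hTu hu fun N hN ↦ by
      have := ih _ (by omega) (swapLast (compSecond (swapLast T) N.subtype)) (by omega) rfl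
      rw [← Nat.eq_sub_of_add_eq hN]
      exact this.of_swapLast
    convert this.of_swapLast using 1
    omega
  push Not at hrow
  by_cases hcol : finrank K W + 1 < finrank K V ∧ ∃ w, w ≠ 0 ∧ IsProductAt T w
  · obtain ⟨hlt, w, hw, hTw⟩ := hcol
    have := HasRankLE.of_finrank_ker (r := finrank K W + (finrank K V - 1) - 1) hTw hw fun N hN ↦ by
      rw [← Nat.eq_sub_of_add_eq hN]
      exact ih _ (by omega) (compSecond T N.subtype) (by omega) rfl
    convert this using 1
    omega
  by_cases hpair : finrank K W + 1 = finrank K V ∧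
      ∃ w w', LinearIndependent K ![w, w'] ∧ IsProductAt T w ∧ IsProductAt T w'
  · obtain ⟨heq, w, w', hind, hTw, hTw'⟩ := hpair
    have hker : ∀ N : Submodule K V, finrank K N + 1 = finrank K V → ∀ N' : Submodule K N,
        finrank K N' + 1 = finrank K N →
        HasRankLE (compSecond (compSecond T N.subtype) N'.subtype)
          (finrank K W + finrank K V - 3) := fun N hN N' hN' ↦ by
      convert (ih _ (by omega) (swapLast (compSecond (compSecond T N.subtype) N'.subtype))
        (by omega) rfl).of_swapLast using 1
      omega
    have h2 := hind.fintype_card_le_finrank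
    simp only [Fintype.card_fin] at h2
    obtain ⟨b, hb⟩ := hind.exists_basis_sum (κ := Fin (finrank K V - 2)) (by simp; omega)
    have hw : b.coord (.inl 0) w = 1 := by simp [← show b (.inl 0) = w from hb 0]
    have hw' : b.coord (.inl 0) w' = 0 := by simp [← show b (.inl 1) = w' from hb 1]
    have hne : b.coord (.inl 0) ≠ 0 := fun h0 ↦ by simp [h0] at hw
    have := HasRankLE.of_ker hTw hw (.of_finrank_ker (w := ⟨w', hw'⟩) hTw'
      (fun h0 ↦ hind.ne_zero 1 (congrArg Subtype.val h0))
      (hker _ (Module.Dual.finrank_ker_add_one_of_ne_zero hne)))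
    convert this using 1
    omega
  by_cases hz : ∃ z₀ w,
      (∀ z, finrank K (LinearMap.range (T z)) ≤ finrank K (LinearMap.range (T z₀))) ∧
      T z₀ w = 0 ∧ ¬IsProductAt T w
  · obtain ⟨z₀, w, hz₀, hw, hTw⟩ := hz
    exact hasRankLE_of_not_isProductAt hU hz₀ hw hTw hrow hVW
  push Not at hcol hpair hz
  have hex : ∀ z, ∃ w, w ≠ 0 ∧ T z w = 0 := fun z ↦ by
    obtain ⟨w, hw, hw0⟩ := Submodule.exists_mem_ne_zero_of_ne_bot
      (LinearMap.ker_ne_bot_of_finrank_lt (f := T z) (by rwa [Subspace.dual_finrank_eq]))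
    exact ⟨w, hw0, hw⟩
  obtain ⟨z₀, hz₀⟩ : ∃ z₀, ∀ z,
      finrank K (LinearMap.range (T z)) ≤ finrank K (LinearMap.range (T z₀)) := by
    have hbdd : BddAbove (Set.range fun z ↦ finrank K (LinearMap.range (T z))) :=
      ⟨_, Set.forall_mem_range.2 fun z ↦ Submodule.finrank_le _⟩
    obtain ⟨z₀, hz₀⟩ := Nat.sSup_mem (Set.range_nonempty _) hbdd
    exact ⟨z₀, fun z ↦ (le_csSup hbdd ⟨z, rfl⟩).trans_eq hz₀.symm⟩
  obtain ⟨w, hw, hw0⟩ := hex z₀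
  have heq : finrank K W + 1 = finrank K V := by
    by_contra hne
    exact hcol (by omega) w hw (hz z₀ w hz₀ hw0)
  have hzero : ∀ z, T z w = 0 := fun z ↦ by
    obtain ⟨ε, hε, hε0⟩ := (((eventually_finrank_range_le (T z₀) (T z)).filter_mono
      nhdsWithin_le_nhds).and (self_mem_nhdsWithin (s := {0}ᶜ))).exists
    rw [← map_smul, ← map_add] at hε
    obtain ⟨w', hw', hw0'⟩ := hex (z₀ + ε • z)
    have hdep : ¬LinearIndependent K ![w, w'] := fun h ↦
      hpair heq w w' h (hz z₀ w hz₀ hw0) (hz _ w' (fun z ↦ (hz₀ z).trans hε) hw0')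
    rw [LinearIndependent.pair_iff' hw] at hdep
    push Not at hdep
    obtain ⟨c, rfl⟩ := hdep
    have hc : c ≠ 0 := fun h0 ↦ hw' (by rw [h0, zero_smul])
    simpa [hw0, hc, show ε ≠ 0 from hε0] using hw0'
  have hW1 : 1 < finrank K W := by
    by_contra hle
    obtain ⟨w', hind⟩ := exists_linearIndependent_pair_of_one_lt_finrank (R := K) (by omega) hw
    exact hpair heq w w' hind (.of_finrank_eq_one T (by omega) w)
      (.of_finrank_eq_one T (by omega) w')
  refine hasRankLE_of_range_eq_top hU (z₀ := z₀) ?_ hw hzero hW1 hVW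
  have hker : finrank K (LinearMap.ker (T z₀)) ≤ 1 := by
    by_contra! hlt
    obtain ⟨w', hind⟩ := exists_linearIndependent_pair_of_one_lt_finrank (R := K) hlt
      (x := ⟨w, hw0⟩) fun h0 ↦ hw (congrArg Subtype.val h0)
    have := hind.map' _ (Submodule.ker_subtype _)
    rw [show _ ∘ _ = ![w, (w' : V)] by ext i; fin_cases i <;> rfl] at this
    exact hpair heq w w' this (hz z₀ w hz₀ hw0) (hz z₀ w' hz₀ w'.2)
  have := (T z₀).finrank_range_add_finrank_ker
  have hle := Submodule.finrank_le (LinearMap.range (T z₀))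
  refine Submodule.eq_top_of_finrank_eq ?_
  rw [Subspace.dual_finrank_eq] at hle ⊢
  omega

end ThreeSlices

/-- Rank bounds for trilinear forms are rank bounds for tensors. -/
theorem tensorRank_le_of_hasRankLE {K α β γ : Type*} [Field K] [Fintype α] [Fintype β] [Fintype γ]
    [DecidableEq α] [DecidableEq β] [DecidableEq γ] (A : γ → Matrix α β K) {r : ℕ}
    (h : ∀ T : (γ → K) →ₗ[K] (β → K) →ₗ[K] (α → K) →ₗ[K] K, HasRankLE T r) :
    tensorRank K A ≤ r := by
  let S : γ → (β → K) →ₗ[K] (α → K) →ₗ[K] K := fun k ↦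
    ∑ i, ∑ j, A k i j • (LinearMap.proj (R := K) (φ := fun _ : β ↦ K) j).smulRight
      (LinearMap.proj (R := K) (φ := fun _ : α ↦ K) i)
  obtain ⟨φ, ψ, χ, hT⟩ :=
    h (∑ k, (LinearMap.proj (R := K) (φ := fun _ : γ ↦ K) k).smulRight (S k))
  refine Nat.sInf_le ⟨fun l i ↦ ψ l (Pi.single i 1), fun l j ↦ φ l (Pi.single j 1),
    fun l k ↦ χ l (Pi.single k 1), fun k ↦ Matrix.ext fun i j ↦ ?_⟩
  have := hT (Pi.single k 1) (Pi.single j 1) (Pi.single i 1)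
  have hS : S k (Pi.single j 1) (Pi.single i 1) = A k i j := by
    simp [S, LinearMap.sum_apply, Pi.single_apply]
  simp only [LinearMap.sum_apply, LinearMap.smulRight_apply, LinearMap.proj_apply,
    Pi.single_apply, ite_smul, one_smul, zero_smul, Finset.sum_ite_eq', Finset.mem_univ,
    if_true, hS] at this
  rw [this, Matrix.sum_apply]
  refine Finset.sum_congr rfl fun l _ ↦ ?_
  simp only [Matrix.smul_apply, Matrix.vecMulVec_apply, smul_eq_mul]
  ring

end TrilinearForms

/-- If `𝔽` is `ℝ` or `ℂ` and `m < n`, then every `m × n × 3` tensor over `𝔽` has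
rank at most `m + n - 1`. -/
theorem stmt17 {𝔽 : Type*} [RCLike 𝔽] {m n : ℕ}
    (hm : 0 < m) (hmn : m < n) :
    maxRank 𝔽 m n 3 ≤ m + n - 1 := by
  refine csSup_le' ?_
  rintro _ ⟨A, rfl⟩
  refine tensorRank_le_of_hasRankLE A fun T ↦ ?_
  simpa using hasRankLE_of_finrank_eq_three (by simp) T (by simpa using hmn)
end
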